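/- arXiv:1910.13686 — 9 statements merged into one kernel-verified Lean document; each statement's English description precedes it below -/
import Mathlib

section
/- Let K, D > 0. For ξ ∈ ℝ and θ ∈ (0,1), let b_{θ,ξ,D} be the unique real number in [ξ, ξ+D] with ∫_ξ^{b_{θ,ξ,D}} e^{−Kt²/2} dt = θ · ∫_ξ^{ξ+D} e^{−Kt²/2} dt, set f_{ξ,D}(θ) := e^{−K b_{θ,ξ,D}²/2} / ∫_ξ^{ξ+D} e^{−Kt²/2} dt, and define I_{K,D}(θ) := inf_{ξ ∈ [−D,0]} f_{ξ,D}(θ). Let a_{K,θ} be the unique real with √(K/(2π)) ∫_{−∞}^{a_{K,θ}} e^{−Kt²/2} dt = θ and set I_{K,∞}(θ) := √(K/(2π)) e^{−K a_{K,θ}²/2}. Then for every θ ∈ (0,1): I_{K,D}(θ) − I_{K,∞}(θ) > (√K/π) · e^{−KD²} / (√K · D + 1). -/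
open MeasureTheory Real Set

noncomputable def gw (K t : ℝ) : ℝ := Real.exp (-K * t ^ 2 / 2)
noncomputable def gG (K x : ℝ) : ℝ := ∫ t in Iic x, gw K t

lemma gw_int {K : ℝ} (hK : 0 < K) : Integrable (gw K) := by
  have := integrable_exp_neg_mul_sq (b := K / 2) (by positivity)
  convert this using 2
  unfold gw; ring_nf

lemma gw_total {K : ℝ} (hK : 0 < K) : ∫ t, gw K t = √(2 * π / K) := by
  have := integral_gaussian (K / 2)
  rw [show 2 * π / K = π / (K / 2) by field_simp, ← this]
  congr 1
  funext t
  unfold gw; ring_nf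

lemma gw_pos (K t : ℝ) : 0 < gw K t := Real.exp_pos _

lemma gG_sub {K : ℝ} (hK : 0 < K) (x y : ℝ) : ∫ t in x..y, gw K t = gG K y - gG K x := by
  unfold gG
  rw [intervalIntegral.integral_Iic_sub_Iic (gw_int hK).integrableOn (gw_int hK).integrableOn]

lemma gG_neg {K : ℝ} (hK : 0 < K) (x : ℝ) : gG K (-x) = √(2 * π / K) - gG K x := by
  have h1 := intervalIntegral.integral_Iic_add_Ioi (b := x) (f := gw K) (μ := volume) (gw_int hK).integrableOn (gw_int hK).integrableOn
  rw [gw_total hK] at h1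
  have h2 := integral_comp_neg_Iic (-x) (gw K)
  have h3 : ∀ t, gw K (-t) = gw K t := fun t => by unfold gw; ring_nf
  simp only [h3, neg_neg] at h2
  unfold gG
  linarith

lemma gG_mono {K : ℝ} (hK : 0 < K) {x y : ℝ} (h : x ≤ y) : gG K x ≤ gG K y := by
  have := gG_sub hK x y
  have h2 : 0 ≤ ∫ t in x..y, gw K t :=
    intervalIntegral.integral_nonneg h (fun t _ => (gw_pos K t).le)
  linarith

lemma gG_nonneg (K x : ℝ) : 0 ≤ gG K x :=
  integral_nonneg (fun t => (gw_pos K t).le)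

lemma gw_cont (K : ℝ) : Continuous (gw K) := by unfold gw; fun_prop

lemma tangent {K : ℝ} (hK : 0 < K) (a b : ℝ) :
    gw K a ≤ gw K b - K * b * (gG K a - gG K b) := by
  have hd : ∀ t, HasDerivAt (gw K) (-K * t * gw K t) t := by
    intro t
    have h : HasDerivAt (fun t : ℝ => -K * t ^ 2 / 2) (-K * t) t := by
      have := (((hasDerivAt_id t).pow 2).const_mul (-K)).div_const 2
      refine this.congr_deriv ?_
      norm_num
      ring
    have := h.exp
    unfold gw
    convert this using 1; ring
  have hc := gw_cont K
  have h1 : ∫ t in b..a, -K * t * gw K t = gw K a - gw K b :=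
    intervalIntegral.integral_eq_sub_of_hasDerivAt (fun t _ => hd t)
      (Continuous.intervalIntegrable (by fun_prop) _ _)
  have h2 : ∫ t in b..a, (K * (t - b) * gw K t) = -(gw K a - gw K b) - K * b * (gG K a - gG K b) := by
    rw [← h1, ← gG_sub hK, ← intervalIntegral.integral_const_mul, ← intervalIntegral.integral_neg,
      ← intervalIntegral.integral_sub (Continuous.intervalIntegrable (by fun_prop) _ _)
        (Continuous.intervalIntegrable (by fun_prop) _ _)]
    congr 1; funext t; ring
  have h3 : 0 ≤ ∫ t in b..a, (K * (t - b) * gw K t) := by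
    rcases le_total b a with h | h
    · apply intervalIntegral.integral_nonneg h
      intro t ht
      have := gw_pos K t
      have := ht.1
      have : 0 ≤ t - b := by linarith
      positivity
    · rw [intervalIntegral.integral_symm, ← intervalIntegral.integral_neg]
      apply intervalIntegral.integral_nonneg h
      intro t ht
      have h1 := gw_pos K t
      have := ht.2
      have : 0 ≤ b - t := by linarith
      have : 0 ≤ K * (b - t) * gw K t := by positivity
      linarith
  linarith

lemma gG_tendsto {K : ℝ} (hK : 0 < K) : Filter.Tendsto (gG K) Filter.atBot (nhds 0) := by
  have h := intervalIntegral_tendsto_integral_Iic (f := gw K) (μ := volume) (a := id) (l := Filter.atBot) 0 (gw_int hK).integrableOn Filter.tendsto_id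
  simp only [gG_sub hK] at h
  have h2 := (tendsto_const_nhds (x := gG K 0)).sub h
  change Filter.Tendsto _ _ (nhds (gG K 0 - gG K 0)) at h2
  simpa using h2

lemma mills {K : ℝ} (hK : 0 < K) (b : ℝ) : 0 ≤ gw K b + K * b * gG K b := by
  have h : Filter.Tendsto (fun a => gw K b - K * b * (gG K a - gG K b)) Filter.atBot
      (nhds (gw K b - K * b * (0 - gG K b))) :=
    tendsto_const_nhds.sub (((gG_tendsto hK).sub_const _).const_mul _)
  have := ge_of_tendsto' (b := 0) h (fun a => (gw_pos K a).le.trans (tangent hK a b))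
  linarith

lemma gw_neg (K b : ℝ) : gw K (-b) = gw K b := by unfold gw; ring_nf

lemma mills1 {K : ℝ} (hK : 0 < K) {b : ℝ} (hb : 0 ≤ b) : 1 ≤ gw K b + K * b * gG K b := by
  have h := tangent hK 0 b
  have h0 : gw K 0 = 1 := by simp [gw]
  have : 0 ≤ K * b * gG K 0 := by have := gG_nonneg K 0; positivity
  rw [h0] at h
  linarith

lemma tail {K D : ℝ} (hK : 0 < K) : 
    Real.exp (-K * D ^ 2) * (√(π / K) / 2) ≤ gG K (-D) := by
  have h2 := integral_comp_neg_Iic (-D) (gw K)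
  simp only [gw_neg, neg_neg] at h2
  unfold gG
  rw [h2]
  have h3 : ∫ t in Ioi D, gw K t = ∫ t in Ioi 0, gw K (t + D) := by
    have := (measurePreserving_add_right volume D).setIntegral_preimage_emb
      (measurableEmbedding_addRight D) (gw K) (Ioi D)
    rw [← this]; simp
  rw [h3, ← integral_gaussian_Ioi, ← integral_const_mul]
  apply setIntegral_mono
  · exact ((integrable_exp_neg_mul_sq hK).const_mul _).integrableOn
  · exact ((gw_int hK).comp_add_right D).integrableOn
  · intro s
    simp only [gw]
    rw [← Real.exp_add]
    apply Real.exp_le_exp.2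
    nlinarith [mul_nonneg hK.le (sq_nonneg (s - D))]

lemma key {K D : ℝ} (hK : 0 < K) (hD : 0 < D) {θ ξ a b : ℝ} (hξ : ξ ∈ Icc (-D) 0)
    (hb : gG K b - gG K ξ = θ * (gG K (ξ + D) - gG K ξ))
    (ha : gG K a = θ * √(2 * π / K)) :
    Real.exp (-K * D ^ 2) / (2 * √2 * D) + gw K a / √(2 * π / K) ≤
      gw K b / (gG K (ξ + D) - gG K ξ) := by
  have hU := tail (D := D) hK
  have hsq : √(2 * π / K) = √2 * √(π / K) := by
    rw [← Real.sqrt_mul (by norm_num)]; congr 1; ring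
  have hP : gG K (-D) ≤ gG K ξ := gG_mono hK hξ.1
  have hQ : gG K (-D) ≤ √(2 * π / K) - gG K (ξ + D) := by
    rw [← gG_neg hK]; exact gG_mono hK (by linarith [hξ.2])
  have hZ : 0 < √(2 * π / K) := by positivity
  have hM : 0 < gG K (ξ + D) - gG K ξ := by
    rw [← gG_sub hK]
    exact intervalIntegral.intervalIntegral_pos_of_pos ((gw_cont K).intervalIntegrable _ _)
      (gw_pos K) (by linarith)
  have hMD : gG K (ξ + D) - gG K ξ ≤ D := by
    rw [← gG_sub hK]
    have : ∫ t in ξ..(ξ+D), gw K t ≤ ∫ t in ξ..(ξ+D), (1:ℝ) := by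
      apply intervalIntegral.integral_mono (by linarith) ((gw_cont K).intervalIntegrable _ _)
        (by simp)
      intro t
      simp only [gw]
      apply Real.exp_le_one_iff.2
      nlinarith [mul_nonneg hK.le (sq_nonneg t)]
    simpa using this
  have hT := tangent hK a b
  have hU0 := gG_nonneg K (-D)
  have hm1 := mills hK b
  have hm2 := mills hK (-b)
  rw [gw_neg, gG_neg hK] at hm2
  have hk : gG K (-D) ≤ gG K ξ * (gw K b + K * (-b) * (√(2 * π / K) - gG K b)) + 
      (√(2 * π / K) - gG K (ξ + D)) * (gw K b + K * b * gG K b) := by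
    rcases le_total 0 b with h | h
    · have := mills1 hK h
      nlinarith [mul_nonneg (hU0.trans hP) hm2]
    · have := mills1 hK (neg_nonneg.2 h)
      rw [gw_neg, gG_neg hK] at this
      nlinarith [mul_nonneg (hU0.trans hQ) hm1]
  set Z := √(2 * π / K)
  set M := gG K (ξ + D) - gG K ξ with hMdef
  have hmain : gG K (-D) ≤ Z * gw K b - M * gw K a := by
    have h1 := mul_le_mul_of_nonneg_left hT hM.le
    have h2 : M * gG K a = Z * (gG K b - gG K ξ) := by rw [ha, hb]; ring
    have h3 : M * (gw K b - K * b * (gG K a - gG K b)) = M * gw K b - K * b * (Z * (gG K b - gG K ξ) - M * gG K b) := by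
      rw [← h2]; ring
    have h4 : gG K (ξ + D) = M + gG K ξ := by rw [hMdef]; ring
    rw [h4] at hk
    nlinarith
  have e1 : gw K b / M - gw K a / Z = (Z * gw K b - M * gw K a) / (M * Z) := by
    field_simp
  have e2 : gG K (-D) / (D * Z) ≤ (Z * gw K b - M * gw K a) / (M * Z) := by
    gcongr
    exact hU0.trans hmain
  have e3 : Real.exp (-K * D ^ 2) * (√(π / K) / 2) / (D * Z) ≤ gG K (-D) / (D * Z) := by gcongr
  have e4 : Real.exp (-K * D ^ 2) * (√(π / K) / 2) / (D * Z) = Real.exp (-K * D ^ 2) / (2 * √2 * D) := by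
    rw [hsq]
    have : 0 < √(π / K) := by positivity
    field_simp
  linarith

theorem stmt0 (K D : ℝ) (hK : 0 < K) (hD : 0 < D)
    (b : ℝ → ℝ → ℝ)
    (hb : ∀ θ ∈ Ioo (0:ℝ) 1, ∀ ξ : ℝ,
      b θ ξ ∈ Icc ξ (ξ + D) ∧
      (∫ t in ξ..(b θ ξ), Real.exp (-K * t ^ 2 / 2)) =
        θ * ∫ t in ξ..(ξ + D), Real.exp (-K * t ^ 2 / 2))
    (f : ℝ → ℝ → ℝ)
    (hf : ∀ θ ξ : ℝ, f θ ξ =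
      Real.exp (-K * (b θ ξ) ^ 2 / 2) / ∫ t in ξ..(ξ + D), Real.exp (-K * t ^ 2 / 2))
    (IKD : ℝ → ℝ)
    (hIKD : ∀ θ : ℝ, IKD θ = sInf (f θ '' Icc (-D) 0))
    (a : ℝ → ℝ)
    (ha : ∀ θ ∈ Ioo (0:ℝ) 1,
      Real.sqrt (K / (2 * π)) * ∫ t in Iic (a θ), Real.exp (-K * t ^ 2 / 2) = θ)
    (IKinf : ℝ → ℝ)
    (hIKinf : ∀ θ : ℝ, IKinf θ = Real.sqrt (K / (2 * π)) * Real.exp (-K * (a θ) ^ 2 / 2)) :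
    ∀ θ ∈ Ioo (0:ℝ) 1,
      IKD θ - IKinf θ >
        Real.sqrt K / π * Real.exp (-K * D ^ 2) / (Real.sqrt K * D + 1) := by
  intro θ hθ
  have hZ : 0 < √(2 * π / K) := by positivity
  have hc : √(K / (2 * π)) = (√(2 * π / K))⁻¹ := by
    rw [← Real.sqrt_inv, inv_div]
  have ha' : gG K (a θ) = θ * √(2 * π / K) := by
    have := ha θ hθ
    rw [hc] at this
    change _ * gG K (a θ) = θ at this
    have h2 := congrArg (fun x => x * √(2 * π / K)) this
    rw [← h2]; field_simp
  have hlow : Real.exp (-K * D ^ 2) / (2 * √2 * D) + IKinf θ ≤ IKD θ := by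
    rw [hIKD]
    apply le_csInf
    · exact ⟨_, mem_image_of_mem _ (⟨by linarith, le_refl _⟩ : (0:ℝ) ∈ Icc (-D) 0)⟩
    · rintro _ ⟨ξ, hξ, rfl⟩
      have h1 := (hb θ hθ ξ).2
      change ∫ t in ξ..(b θ ξ), gw K t = θ * ∫ t in ξ..(ξ + D), gw K t at h1
      rw [gG_sub hK, gG_sub hK] at h1
      have := key hK hD hξ h1 ha'
      rw [hf, hIKinf, hc]
      change _ + _ * gw K (a θ) ≤ gw K (b θ ξ) / ∫ t in ξ..(ξ + D), gw K t
      rw [gG_sub hK]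
      rw [div_eq_inv_mul (gw K (a θ))] at this
      exact this
  have hs : 0 < √K := by positivity
  have h2 : 2 * √2 < π := by
    have : √2 < 1.5 := by
      rw [Real.sqrt_lt' (by norm_num)]; norm_num
    linarith [Real.pi_gt_three]
  have h3 : Real.sqrt K / π * Real.exp (-K * D ^ 2) / (Real.sqrt K * D + 1)
      < Real.exp (-K * D ^ 2) / (2 * √2 * D) := by
    have he := Real.exp_pos (-K * D ^ 2)
    rw [show Real.sqrt K / π * Real.exp (-K * D ^ 2) / (Real.sqrt K * D + 1) =
      Real.exp (-K * D ^ 2) * (√K / (π * (√K * D + 1))) by field_simp, div_eq_mul_inv]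
    apply mul_lt_mul_of_pos_left _ he
    rw [← one_div (2 * √2 * D), ← div_eq_mul_inv, div_lt_div_iff₀ (by positivity) (by positivity)]
    nlinarith [mul_lt_mul_of_pos_right h2 (mul_pos hs hD), Real.pi_pos]
  linarith
end

section
/- For all K, D > 0: 1 / ∫_{−D}^{D} e^{−Kt²/2} dt − √(K/(2π)) ≥ (√K/π) · e^{−KD²/2} / (√K · D + 1). -/
open MeasureTheory Real Set

open Filter Topology in
theorem aux_key (s D : ℝ) (hs : 0 < s) (hD : 0 < D) :
    (∫ t in (-D)..D, Real.exp (-(s ^ 2 / 2) * t ^ 2)) +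
      2 * Real.exp (-(s ^ 2 / 2) * D ^ 2) / (s * (s * D + 1)) ≤ Real.sqrt (π / (s ^ 2 / 2)) := by
  set f : ℝ → ℝ := fun t => Real.exp (-(s ^ 2 / 2) * t ^ 2) with hf
  have hfc : Continuous f := by fun_prop
  set h : ℝ → ℝ := fun x => (∫ t in (-x)..x, f t) + 2 * f x / (s * (s * x + 1)) with hh
  have hfd : ∀ x, HasDerivAt f (f x * (-(s ^ 2) * x)) x := by
    intro x
    have h1 : HasDerivAt (fun t : ℝ => -(s ^ 2 / 2) * t ^ 2) (-(s ^ 2 / 2) * (2 * x)) x := by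
      simpa using (hasDerivAt_pow 2 x).const_mul (-(s ^ 2 / 2))
    convert h1.exp using 1
    simp only [hf]; ring
  have hI : ∀ x, HasDerivAt (fun x => ∫ t in (-x)..x, f t) (2 * f x) x := by
    intro x
    have hF : ∀ y, HasDerivAt (fun u => ∫ t in (0:ℝ)..u, f t) (f y) y := fun y =>
      intervalIntegral.integral_hasDerivAt_right (hfc.intervalIntegrable _ _)
        (hfc.stronglyMeasurableAtFilter _ _) hfc.continuousAt
    have h2 : HasDerivAt (fun u => ∫ t in (0:ℝ)..(-u), f t) (f (-x) * (-1)) x :=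
      (hF (-x)).comp x (hasDerivAt_neg x)
    have h3 := (hF x).sub h2
    have he : f (-x) = f x := by simp [hf]
    rw [he] at h3
    have e1 : (fun x => ∫ t in (-x)..x, f t) =
        (fun u => ∫ t in (0:ℝ)..u, f t) - fun u => ∫ t in (0:ℝ)..(-u), f t := by
      funext y
      simp only [Pi.sub_apply]
      rw [intervalIntegral.integral_interval_sub_left (hfc.intervalIntegrable _ _)
        (hfc.intervalIntegrable _ _)]
    have e2 : 2 * f x = f x - f x * (-1) := by ring
    rw [e1, e2]
    exact h3
  have hd : ∀ x, 0 < x → HasDerivAt h (2 * f x + ((2 * (f x * (-(s ^ 2) * x))) * (s * (s * x + 1))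
      - 2 * f x * (s * s)) / (s * (s * x + 1)) ^ 2) x := by
    intro x hx
    have hden : HasDerivAt (fun x : ℝ => s * (s * x + 1)) (s * s) x := by
      simpa using (((hasDerivAt_id x).const_mul s).add_const 1).const_mul s
    exact (hI x).add (((hfd x).const_mul 2).div hden (by positivity))
  have hmono : MonotoneOn h (Ioi 0) := by
    apply monotoneOn_of_deriv_nonneg (convex_Ioi 0)
    · exact fun x hx => (hd x hx).continuousAt.continuousWithinAt
    · intro x hx
      rw [interior_Ioi] at hx
      exact (hd x hx).differentiableAt.differentiableWithinAt
    · intro x hx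
      rw [interior_Ioi] at hx
      have hx' : 0 < x := hx
      rw [(hd x hx).deriv]
      have hfx : 0 < f x := Real.exp_pos _
      have : 2 * f x + ((2 * (f x * (-(s ^ 2) * x))) * (s * (s * x + 1))
          - 2 * f x * (s * s)) / (s * (s * x + 1)) ^ 2 = 2 * f x * (s * x) / (s * x + 1) ^ 2 := by
        have : s * x + 1 ≠ 0 := by positivity
        field_simp
        ring
      rw [this]
      positivity
  have hlim : Tendsto h atTop (𝓝 (Real.sqrt (π / (s ^ 2 / 2)))) := by
    have h1 : Tendsto (fun x => ∫ t in (-x)..x, f t) atTop (𝓝 (∫ t, f t)) :=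
      intervalIntegral_tendsto_integral (integrable_exp_neg_mul_sq (by positivity))
        tendsto_neg_atTop_atBot tendsto_id
    have h2 : Tendsto (fun x => 2 * f x / (s * (s * x + 1))) atTop (𝓝 0) := by
      have h3 : Tendsto (fun x : ℝ => 2 / (s * (s * x + 1))) atTop (𝓝 0) := by
        apply Tendsto.const_div_atTop
        apply Tendsto.const_mul_atTop hs
        exact tendsto_atTop_add_const_right _ _ (tendsto_id.const_mul_atTop hs)
      refine squeeze_zero' ?_ ?_ h3
      · filter_upwards [eventually_gt_atTop 0] with x hx
        have hfx : 0 < f x := Real.exp_pos _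
        positivity
      · filter_upwards [eventually_gt_atTop 0] with x hx
        have hfx : f x ≤ 1 := Real.exp_le_one_iff.2 (by nlinarith [mul_nonneg (sq_nonneg s) (sq_nonneg x)])
        gcongr
        linarith
    have h3 := h1.add h2
    rw [add_zero, hf, integral_gaussian] at h3
    exact h3
  refine ge_of_tendsto hlim ?_
  filter_upwards [eventually_ge_atTop D] with x hx
  exact hmono hD (lt_of_lt_of_le hD hx) hx

theorem stmt1 (K D : ℝ) (hK : 0 < K) (hD : 0 < D) :
    1 / (∫ t in Icc (-D) D, Real.exp (-K * t ^ 2 / 2)) - Real.sqrt (K / (2 * π)) ≥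
      Real.sqrt K / π * Real.exp (-K * D ^ 2 / 2) / (Real.sqrt K * D + 1) := by
  obtain ⟨s, hs, rfl⟩ : ∃ s : ℝ, 0 < s ∧ K = s ^ 2 :=
    ⟨√K, Real.sqrt_pos.2 hK, (Real.sq_sqrt hK.le).symm⟩
  have key := aux_key s D hs hD
  have e : ∀ t : ℝ, -s ^ 2 * t ^ 2 / 2 = -(s ^ 2 / 2) * t ^ 2 := fun t => by ring
  simp only [e]
  rw [Real.sqrt_sq hs.le, integral_Icc_eq_integral_Ioc,
    ← intervalIntegral.integral_of_le (by linarith)]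
  have hpos : 0 < ∫ t in (-D)..D, Real.exp (-(s ^ 2 / 2) * t ^ 2) :=
    intervalIntegral.intervalIntegral_pos_of_pos
      (Continuous.intervalIntegrable (by fun_prop) _ _) (fun _ => Real.exp_pos _) (by linarith)
  have hL2 : Real.sqrt (π / (s ^ 2 / 2)) ^ 2 = π / (s ^ 2 / 2) := Real.sq_sqrt (by positivity)
  have hLpos : 0 < Real.sqrt (π / (s ^ 2 / 2)) := by positivity
  have hLi : Real.sqrt (s ^ 2 / (2 * π)) = 1 / Real.sqrt (π / (s ^ 2 / 2)) := by
    rw [one_div, ← Real.sqrt_inv]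
    congr 1
    field_simp
  rw [hLi]
  have hφ : 0 < Real.exp (-(s ^ 2 / 2) * D ^ 2) := Real.exp_pos _
  generalize Real.exp (-(s ^ 2 / 2) * D ^ 2) = φ at *
  generalize (∫ t in (-D)..D, Real.exp (-(s ^ 2 / 2) * t ^ 2)) = I at *
  generalize Real.sqrt (π / (s ^ 2 / 2)) = L at *
  have hq : 0 < 2 * φ / (s * (s * D + 1)) := by positivity
  have hIL : I ≤ L := by linarith
  calc 1 / I - 1 / L = (L - I) / (I * L) := by field_simp
    _ ≥ (L - I) / (L * L) := by
        have : 0 ≤ L - I := by linarith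
        gcongr
    _ ≥ (2 * φ / (s * (s * D + 1))) / (L * L) := by
        gcongr
        linarith
    _ = s / π * φ / (s * D + 1) := by
        rw [← pow_two L, hL2]
        field_simp
end

section
/- Let I ⊂ ℝ be a closed interval with nonempty interior, let ψ: I → ℝ be 1-convex (i.e. x ↦ ψ(x) − x²/2 is convex on I), and let m := e^{−ψ} dx be a probability measure on I. Fix θ ∈ (0,1) and δ > 0, and assume a_θ lies in the interior of I, m(I ∩ (−∞, a_θ]) = θ, and e^{−ψ(a_θ)} ≤ e^{−ψ_g(a_θ)} + δ. Then for every x ∈ I: ψ(x) − ψ_g(x) ≥ (ψ'_+(a_θ) − a_θ)(x − a_θ) − log(1 + √(2π) e^{a_θ²/2} δ). -/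
open MeasureTheory Real Set

theorem stmt5 (I : Set ℝ) (hI_closed : IsClosed I) (hI_conv : Convex ℝ I)
    (hI_int : (interior I).Nonempty)
    (ψ : ℝ → ℝ) (hψ : ConvexOn ℝ I (fun x => ψ x - x ^ 2 / 2))
    (θ δ : ℝ) (hθ : θ ∈ Ioo (0:ℝ) 1) (hδ : 0 < δ)
    (aθ : ℝ) (haθI : aθ ∈ interior I)
    (haθ : (1 / Real.sqrt (2 * π)) * ∫ t in Iic aθ, Real.exp (-t ^ 2 / 2) = θ)
    (hprob : (∫ x in I, Real.exp (-ψ x)) = 1)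
    (hmass : (∫ x in I ∩ Iic aθ, Real.exp (-ψ x)) = θ)
    (ψp : ℝ) (hψp : HasDerivWithinAt ψ ψp (Ici aθ) aθ)
    (hdef : Real.exp (-ψ aθ) ≤ Real.exp (-(Real.log (Real.sqrt (2 * π)) + aθ ^ 2 / 2)) + δ) :
    ∀ x ∈ I, ψ x - (Real.log (Real.sqrt (2 * π)) + x ^ 2 / 2) ≥
      (ψp - aθ) * (x - aθ) - Real.log (1 + Real.sqrt (2 * π) * Real.exp (aθ ^ 2 / 2) * δ) := by
  intro x hx
  set L := Real.log (Real.sqrt (2 * π)) with hL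
  have haI : aθ ∈ I := interior_subset haθI
  have hs : 0 < Real.sqrt (2 * π) := by positivity
  have h1 : -ψ aθ ≤ -(L + aθ ^ 2 / 2)
      + Real.log (1 + Real.sqrt (2 * π) * Real.exp (aθ ^ 2 / 2) * δ) := by
    have hp : 0 < 1 + Real.sqrt (2 * π) * Real.exp (aθ ^ 2 / 2) * δ := by positivity
    rw [← Real.exp_le_exp, Real.exp_add, Real.exp_log hp]
    refine hdef.trans (le_of_eq ?_)
    have : Real.exp (-(L + aθ ^ 2 / 2)) * (Real.sqrt (2 * π) * Real.exp (aθ ^ 2 / 2)) = 1 := by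
      rw [← Real.exp_log hs, ← Real.exp_add, ← Real.exp_add, ← hL]
      simp
    linear_combination (-δ) * this
  have hd : HasDerivWithinAt (fun x => ψ x - x ^ 2 / 2) (ψp - aθ) (Ioi aθ) aθ := by
    have h2 : HasDerivWithinAt (fun x : ℝ => x ^ 2 / 2) aθ (Ici aθ) aθ := by
      have := ((hasDerivAt_pow 2 aθ).div_const 2).hasDerivWithinAt (s := Ici aθ)
      have e : ((2 : ℕ) : ℝ) * aθ ^ (2 - 1) / 2 = aθ := by norm_num
      rw [e] at this
      exact this
    exact (hψp.sub h2).mono Ioi_subset_Ici_self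
  have h3 : (ψ aθ - aθ ^ 2 / 2) + (ψp - aθ) * (x - aθ) ≤ ψ x - x ^ 2 / 2 := by
    rcases lt_trichotomy x aθ with h | h | h
    · have hten := (hasDerivWithinAt_iff_tendsto_slope' (by simp)).1 hd
      have hev : ∀ᶠ y in nhdsWithin aθ (Ioi aθ),
          slope (fun x => ψ x - x ^ 2 / 2) x aθ ≤ slope (fun x => ψ x - x ^ 2 / 2) aθ y := by
        filter_upwards [self_mem_nhdsWithin,
          mem_nhdsWithin_of_mem_nhds (mem_interior_iff_mem_nhds.1 haθI)] with y hy hyI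
        have := hψ.slope_mono_adjacent hx hyI h hy
        simpa [slope_def_field] using this
      have := ge_of_tendsto hten hev
      rw [slope_def_field, div_le_iff₀ (by linarith)] at this
      linarith
    · subst h; simp
    · have := hψ.le_slope_of_hasDerivWithinAt_Ioi haI hx h hd
      rw [slope_def_field, le_div_iff₀ (by linarith)] at this
      linarith
  linarith
end

section
/- With the notation below, for every θ ∈ (0,1) there exist constants C(θ) > 0 and δ₀(θ) > 0 with the following property: if I ⊂ ℝ is a closed interval with nonempty interior, ψ: I → ℝ is 1-convex, m := e^{−ψ} dx is a probability measure on I, δ ∈ (0, δ₀(θ)], a_θ lies in the interior of I, m(I ∩ (−∞, a_θ]) = θ, and e^{−ψ(a_θ)} ≤ e^{−ψ_g(a_θ)} + δ, then a_θ − C(θ)·δ ≤ ψ'_−(a_θ) ≤ ψ'_+(a_θ) ≤ a_θ + C(θ)·δ. -/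
open MeasureTheory Real Set

/-- half-line Gaussian Laplace transform -/
noncomputable def GG (p : ℝ) : ℝ := ∫ t in Ioi (0:ℝ), Real.exp (p * t - t ^ 2 / 2)

lemma GG_int (p : ℝ) : Integrable (fun t : ℝ => Real.exp (p * t - t ^ 2 / 2)) := by
  have h := ((integrable_exp_neg_mul_sq (b := 1/2) (by norm_num)).comp_sub_right p).const_mul
    (Real.exp (p^2/2))
  refine h.congr (Filter.Eventually.of_forall fun t => ?_)
  simp only [← Real.exp_add]
  congr 1; ring

lemma GG_pos (p : ℝ) : 0 < GG p := by
  have : NeZero (volume.restrict (Ioi (0:ℝ))) := ⟨by simp⟩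
  exact integral_exp_pos (GG_int p).integrableOn

lemma GG_lt {p q : ℝ} (h : p < q) : GG p < GG q := by
  have hi : IntegrableOn (fun t : ℝ => Real.exp (q * t - t ^ 2 / 2) - Real.exp (p * t - t ^ 2 / 2))
    (Ioi 0) := ((GG_int q).sub (GG_int p)).integrableOn
  have hp : ∀ t ∈ Ioi (0:ℝ), 0 < Real.exp (q * t - t ^ 2 / 2) - Real.exp (p * t - t ^ 2 / 2) := by
    intro t ht
    rw [sub_pos, Real.exp_lt_exp]
    have : p * t < q * t := mul_lt_mul_of_pos_right h ht
    linarith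
  have h0 : 0 < ∫ t in Ioi (0:ℝ), (Real.exp (q * t - t ^ 2 / 2) - Real.exp (p * t - t ^ 2 / 2)) := by
    rw [setIntegral_pos_iff_support_of_nonneg_ae _ hi]
    · refine lt_of_lt_of_le (b := volume (Ioi (0:ℝ))) (by simp) (measure_mono fun t ht => ?_)
      exact ⟨(hp t ht).ne', ht⟩
    · exact (ae_restrict_mem measurableSet_Ioi).mono fun t ht => (hp t ht).le
  rw [integral_sub (GG_int q).integrableOn (GG_int p).integrableOn] at h0
  unfold GG
  linarith

lemma GG_conv (a : ℝ) {s : ℝ} (hs : 0 ≤ s) (hs1 : s ≤ 1) :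
    GG (a - s) ≤ GG a - s * (GG a - GG (a - 1)) := by
  have hc : GG (a - s) ≤ ∫ t in Ioi (0:ℝ), ((1 - s) * Real.exp (a * t - t ^ 2 / 2)
      + s * Real.exp ((a - 1) * t - t ^ 2 / 2)) := by
    refine integral_mono (GG_int _).integrableOn
      (((GG_int a).const_mul _).add ((GG_int (a-1)).const_mul _)).integrableOn fun t => ?_
    have := convexOn_exp.2 (mem_univ (a * t - t ^ 2 / 2)) (mem_univ ((a - 1) * t - t ^ 2 / 2))
      (sub_nonneg.2 hs1) hs (by ring)
    simp only [smul_eq_mul] at this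
    refine le_trans (le_of_eq ?_) this
    congr 1; ring
  rw [integral_add ((GG_int a).const_mul _).integrableOn ((GG_int (a-1)).const_mul _).integrableOn,
    integral_const_mul, integral_const_mul] at hc
  change GG (a - s) ≤ (1 - s) * GG a + s * GG (a - 1) at hc
  linarith

lemma GG_key (a c : ℝ) (hc : 0 < c) : ∃ C > (0:ℝ), ∀ δ : ℝ, 0 < δ → C * δ ≤ 1 → ∀ p : ℝ,
    c * GG a ≤ (c + δ) * GG p → a - C * δ ≤ p := by
  have hK : 0 < GG a - GG (a - 1) := sub_pos.2 (GG_lt (by linarith))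
  have hG := GG_pos a
  refine ⟨2 * GG a / (c * (GG a - GG (a - 1))), by positivity, fun δ hδ h1 p hp => ?_⟩
  set C := 2 * GG a / (c * (GG a - GG (a - 1))) with hC
  have hCK : c * C * (GG a - GG (a - 1)) = 2 * GG a := by rw [hC]; field_simp
  have hC0 : 0 < C := by positivity
  by_contra! hlt
  have h2 := (GG_lt hlt).le.trans (GG_conv a (by positivity) h1)
  have h3 : (c + δ) * GG p ≤ (c + δ) * (GG a - C * δ * (GG a - GG (a - 1))) :=
    mul_le_mul_of_nonneg_left h2 (by positivity)
  have h4 : 0 ≤ δ * (C * δ * (GG a - GG (a - 1))) := by positivity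
  have h5 : c * (C * δ * (GG a - GG (a - 1))) = 2 * GG a * δ := by rw [← hCK]; ring
  nlinarith [mul_pos hδ hG]

lemma GG_left (a p : ℝ) :
    ∫ x in Iic a, Real.exp (-(p * (x - a) + (x - a) ^ 2 / 2)) = GG p := by
  have := (Measure.measurePreserving_sub_left volume a).setIntegral_preimage_emb
    (MeasurableEquiv.subLeft a).measurableEmbedding
    (fun t : ℝ => Real.exp (p * t - t ^ 2 / 2)) (Ici 0)
  rw [integral_Ici_eq_integral_Ioi] at this
  rw [GG, ← this]
  have e : (fun x => a - x) ⁻¹' Ici 0 = Iic a := by ext; simp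
  rw [e]
  congr 1; ext x; congr 1; ring

lemma GG_right (a p : ℝ) :
    ∫ x in Ioi a, Real.exp (-(p * (x - a) + (x - a) ^ 2 / 2)) = GG (-p) := by
  have := (measurePreserving_sub_right volume a).setIntegral_preimage_emb
    (MeasurableEquiv.subRight a).measurableEmbedding
    (fun t : ℝ => Real.exp (-p * t - t ^ 2 / 2)) (Ioi 0)
  rw [GG, ← this]
  have e : (fun x => x - a) ⁻¹' Ioi 0 = Ioi a := by ext; simp
  rw [e]
  congr 1; ext x; congr 1; ring

lemma GG_int' (a p : ℝ) :
    Integrable (fun x : ℝ => Real.exp (-(p * (x - a) + (x - a) ^ 2 / 2))) := by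
  refine ((GG_int (-p)).comp_sub_right a).congr (Filter.Eventually.of_forall fun t => ?_)
  simp only
  congr 1; ring

lemma bound_side (I S : Set ℝ) (hI : MeasurableSet I) (hS : MeasurableSet S) (ψ : ℝ → ℝ) (a p : ℝ)
    (h : ∀ x ∈ I ∩ S, ψ a + (p * (x - a) + (x - a) ^ 2 / 2) ≤ ψ x) :
    ∫ x in I ∩ S, Real.exp (-ψ x) ≤
      Real.exp (-ψ a) * ∫ x in S, Real.exp (-(p * (x - a) + (x - a) ^ 2 / 2)) := by
  rw [← integral_const_mul]
  have hint := (GG_int' a p).const_mul (Real.exp (-ψ a))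
  calc _ ≤ ∫ x in I ∩ S, Real.exp (-ψ a) * Real.exp (-(p * (x - a) + (x - a) ^ 2 / 2)) := by
        refine integral_mono_of_nonneg (Filter.Eventually.of_forall fun x => (Real.exp_pos _).le)
          hint.integrableOn ?_
        refine (ae_restrict_mem (hI.inter hS)).mono fun x hx => ?_
        simp only [← Real.exp_add]
        rw [Real.exp_le_exp]
        linarith [h x hx]
    _ ≤ _ := by
        refine setIntegral_mono_set hint.integrableOn
          (Filter.Eventually.of_forall fun x => by simp only [Pi.zero_apply]; positivity) ?_
        exact inter_subset_right.eventuallyLE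



theorem stmt6 :
    ∀ θ ∈ Ioo (0:ℝ) 1, ∀ aθ : ℝ,
      (1 / Real.sqrt (2 * π)) * (∫ t in Iic aθ, Real.exp (-t ^ 2 / 2)) = θ →
      ∃ C > (0:ℝ), ∃ δ₀ > (0:ℝ),
        ∀ (I : Set ℝ), IsClosed I → Convex ℝ I → (interior I).Nonempty →
        ∀ ψ : ℝ → ℝ, ConvexOn ℝ I (fun x => ψ x - x ^ 2 / 2) →
        (∫ x in I, Real.exp (-ψ x)) = 1 →
        ∀ δ : ℝ, 0 < δ → δ ≤ δ₀ →
        aθ ∈ interior I →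
        (∫ x in I ∩ Iic aθ, Real.exp (-ψ x)) = θ →
        Real.exp (-ψ aθ) ≤ Real.exp (-(Real.log (Real.sqrt (2 * π)) + aθ ^ 2 / 2)) + δ →
        ∀ ψm ψp : ℝ, HasDerivWithinAt ψ ψm (Iic aθ) aθ → HasDerivWithinAt ψ ψp (Ici aθ) aθ →
          aθ - C * δ ≤ ψm ∧ ψm ≤ ψp ∧ ψp ≤ aθ + C * δ := by
  intro θ hθ a hga
  have hsq : 0 < Real.sqrt (2 * π) := Real.sqrt_pos.2 (by positivity)
  set φ := Real.exp (-(Real.log (Real.sqrt (2 * π)) + a ^ 2 / 2)) with hφ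
  have hφ0 : 0 < φ := Real.exp_pos _
  have hφ' : φ = 1 / Real.sqrt (2 * π) * Real.exp (-a ^ 2 / 2) := by
    rw [hφ, neg_add, Real.exp_add, Real.exp_neg, Real.exp_log hsq]
    congr 2
    · simp
    · ring
  have hpt : ∀ t : ℝ, Real.exp (-t ^ 2 / 2)
      = Real.exp (-a ^ 2 / 2) * Real.exp (-(a * (t - a) + (t - a) ^ 2 / 2)) := by
    intro t
    rw [← Real.exp_add]; congr 1; ring
  have hgI : Integrable (fun t : ℝ => Real.exp (-t ^ 2 / 2)) := by
    exact ((GG_int' a a).const_mul _).congr (Filter.Eventually.of_forall fun t => (hpt t).symm)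
  have hL : φ * GG a = θ := by
    rw [← hga, ← GG_left a a, hφ', mul_assoc, ← integral_const_mul]
    simp_rw [← hpt]
  have htot : ∫ t : ℝ, Real.exp (-t ^ 2 / 2) = Real.sqrt (2 * π) := by
    have := integral_gaussian (1/2)
    rw [show π / (1/2) = 2 * π by ring] at this
    rw [← this]
    congr 1; ext t; congr 1; ring
  have hR : φ * GG (-a) = 1 - θ := by
    have hs := intervalIntegral.integral_Iic_add_Ioi (b := a) hgI.integrableOn hgI.integrableOn
    rw [htot] at hs
    have : ∫ t in Ioi a, Real.exp (-t ^ 2 / 2) = Real.exp (-a ^ 2 / 2) * GG (-a) := by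
      rw [← GG_right a a, ← integral_const_mul]
      simp_rw [← hpt]
    rw [this] at hs
    rw [hφ', mul_assoc, ← hga]
    have h1 : 1 / Real.sqrt (2 * π) * Real.sqrt (2 * π) = 1 := by field_simp
    linear_combination (1 / Real.sqrt (2 * π)) * hs + h1
  obtain ⟨C₁, hC₁, h₁⟩ := GG_key a φ hφ0
  obtain ⟨C₂, hC₂, h₂⟩ := GG_key (-a) φ hφ0
  refine ⟨C₁ + C₂, by positivity, 1 / (C₁ + C₂), by positivity, ?_⟩
  intro I hIc _ _ ψ hψ hm δ hδ hδ0 haI hmθ hub ψm ψp hdm hdp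
  have hCδ : (C₁ + C₂) * δ ≤ 1 := by
    rw [le_div_iff₀ (by positivity)] at hδ0; linarith
  have hC1δ : C₁ * δ ≤ 1 := by nlinarith
  have hC2δ : C₂ * δ ≤ 1 := by nlinarith
  have haI' : a ∈ I := interior_subset haI
  have hq : HasDerivAt (fun x : ℝ => x ^ 2 / 2) a a := by
    have := (hasDerivAt_pow 2 a).div_const 2
    simpa using this
  have hdm' : HasDerivWithinAt (fun x => ψ x - x ^ 2 / 2) (ψm - a) (Iio a) a :=
    (hdm.sub hq.hasDerivWithinAt).Iio_of_Iic
  have hdp' : HasDerivWithinAt (fun x => ψ x - x ^ 2 / 2) (ψp - a) (Ioi a) a :=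
    (hdp.sub hq.hasDerivWithinAt).Ioi_of_Ici
  have hbm : ∀ x ∈ I ∩ Iic a, ψ a + (ψm * (x - a) + (x - a) ^ 2 / 2) ≤ ψ x := by
    rintro x ⟨hxI, hxa⟩
    rcases eq_or_lt_of_le (show x ≤ a from hxa) with rfl | hlt
    · simp
    have := hψ.slope_le_of_hasDerivWithinAt_Iio hxI haI' hlt hdm'
    rw [slope_def_field, div_le_iff₀ (sub_pos.2 hlt)] at this
    nlinarith
  have hbp : ∀ x ∈ I ∩ Ioi a, ψ a + (ψp * (x - a) + (x - a) ^ 2 / 2) ≤ ψ x := by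
    rintro x ⟨hxI, hxa⟩
    have hlt : a < x := hxa
    have := hψ.le_slope_of_hasDerivWithinAt_Ioi haI' hxI hlt hdp'
    rw [slope_def_field, le_div_iff₀ (sub_pos.2 hlt)] at this
    nlinarith
  have hl := bound_side I _ hIc.measurableSet measurableSet_Iic ψ a ψm hbm
  have hr := bound_side I _ hIc.measurableSet measurableSet_Ioi ψ a ψp hbp
  rw [GG_left, hmθ] at hl
  have hint : IntegrableOn (fun x => Real.exp (-ψ x)) I := by
    by_contra hn
    rw [integral_undef hn] at hm
    exact zero_ne_one hm
  have hmr : ∫ x in I ∩ Ioi a, Real.exp (-ψ x) = 1 - θ := by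
    have := integral_inter_add_sdiff (measurableSet_Iic (a := a)) hint
    rw [hm, hmθ, Set.sdiff_eq, compl_Iic] at this
    linarith
  rw [GG_right, hmr] at hr
  have hA := h₁ δ hδ hC1δ ψm (by
    rw [hL]; exact hl.trans (mul_le_mul_of_nonneg_right hub (GG_pos _).le))
  have hB := h₂ δ hδ hC2δ (-ψp) (by
    rw [hR]; exact hr.trans (mul_le_mul_of_nonneg_right hub (GG_pos _).le))
  have hmp : ψm - a ≤ ψp - a := by
    have := hψ.leftDeriv_le_rightDeriv_of_mem_interior haI
    rwa [hdm'.derivWithin (uniqueDiffWithinAt_Iio a), hdp'.derivWithin (uniqueDiffWithinAt_Ioi a)]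
      at this
  have e1 : 0 < C₁ * δ := by positivity
  have e2 : 0 < C₂ * δ := by positivity
  exact ⟨by linarith, by linarith, by linarith⟩
end

section
/- With the notation below, for every θ ∈ (0,1) there exist constants ω(θ) > 0 and δ₀(θ) > 0 with the following property: if I ⊂ ℝ is a closed interval with nonempty interior, ψ: I → ℝ is 1-convex, m := e^{−ψ} dx is a probability measure on I, δ ∈ (0, δ₀(θ)], a_θ lies in the interior of I, m(I ∩ (−∞, a_θ]) = θ, and e^{−ψ(a_θ)} ≤ e^{−ψ_g(a_θ)} + δ, then there exist S, T ∈ I with S < a_θ < T such that γ([T, ∞)) ≤ √δ + ω(θ)·δ, γ((−∞, S]) ≤ √δ + ω(θ)·δ, and for every x ∈ [S, T]: ψ(x) − ψ_g(x) ≤ (ψ'_+(a_θ) − a_θ)(x − a_θ) + ω(θ)·√δ. -/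
open MeasureTheory Real Set

noncomputable def gs (x : ℝ) : ℝ := (1 / Real.sqrt (2 * π)) * Real.exp (-x ^ 2 / 2)

lemma gs_pos (x : ℝ) : 0 < gs x := by unfold gs; positivity

lemma gs_cont : Continuous gs := by unfold gs; fun_prop

lemma gs_int : Integrable gs := by
  have := (integrable_exp_neg_mul_sq (b := 1/2) (by norm_num)).const_mul (1 / Real.sqrt (2 * π))
  refine this.congr (Filter.Eventually.of_forall fun x => ?_)
  simp only [gs]; congr 2; ring

lemma gs_total : ∫ x, gs x = 1 := by
  have := integral_gaussian (1/2)
  unfold gs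
  rw [integral_const_mul]
  have h2 : (∫ x : ℝ, Real.exp (-x ^ 2 / 2)) = √(π / (1/2)) := by
    rw [← this]; congr 1; ext x; congr 1; ring
  rw [h2, show π / (1/2) = 2 * π by ring]
  have : 0 < √(2*π) := by positivity
  field_simp

lemma gs_tilt (u p a : ℝ) : Integrable (fun x => gs x * Real.exp (-u - p * (x - a))) := by
  have h := (gs_int.comp_add_right p).const_mul (Real.exp (p^2/2 - u + p * a))
  refine h.congr (Filter.Eventually.of_forall fun x => ?_)
  simp only [gs]
  rw [mul_left_comm, mul_assoc, ← Real.exp_add, ← Real.exp_add]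
  congr 2; ring

lemma p_bound (a u p ε K : ℝ) (A : Set ℝ) (hA : MeasurableSet A)
    (hF : ∫ x in A, gs x ≤ ∫ x in A, gs x * Real.exp (-u - p * (x - a)))
    (hpos : 0 < ∫ x in A, gs x) (h1 : ∫ x in A, gs x ≤ 1)
    (hs : ∀ x ∈ A, p * (x - a) = |p| * |x - a|)
    (hu : Real.exp (-u) ≤ 1 + ε) (hε : 0 < ε)
    (hK : K ≤ ∫ x in A, gs x * (|x - a| / (1 + |x - a|))) (hK0 : 0 < K) (hεK : ε < K) :
    u ≤ 0 ∧ |p| * K ≤ ε := by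
  set m := min |p| 1 with hm
  have hm0 : 0 ≤ m := le_min (abs_nonneg _) zero_le_one
  have hq : Integrable (fun x => gs x * (|x - a| / (1 + |x - a|))) := by
    refine gs_int.mono' ?_ (Filter.Eventually.of_forall fun x => ?_)
    · refine Continuous.aestronglyMeasurable ?_
      refine gs_cont.mul (Continuous.div (by fun_prop) (by fun_prop) fun x => ?_)
      positivity
    · have := gs_pos x
      rw [Real.norm_eq_abs, abs_of_nonneg (by positivity)]
      apply mul_le_of_le_one_right this.le
      rw [div_le_one (by positivity)]; linarith
  have hJ : ∫ x in A, gs x * Real.exp (-u - p * (x - a)) ≤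
      Real.exp (-u) * ((∫ x in A, gs x) - m * ∫ x in A, gs x * (|x - a| / (1 + |x - a|))) := by
    rw [← integral_const_mul, ← integral_sub gs_int.integrableOn (hq.const_mul m).integrableOn,
      ← integral_const_mul]
    refine setIntegral_mono_on (gs_tilt u p a).integrableOn
      ((gs_int.sub (hq.const_mul m)).const_mul _).integrableOn hA fun x hx => ?_
    rw [sub_eq_add_neg, Real.exp_add, hs x hx]
    have hy : 0 ≤ |x - a| := abs_nonneg _
    set y := |x - a|
    have e1 : Real.exp (-(|p| * y)) ≤ 1 - m * (y / (1 + y)) := by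
      have : Real.exp (-(|p| * y)) ≤ Real.exp (-(m * y)) := by
        apply Real.exp_le_exp.2
        have := mul_le_mul_of_nonneg_right (min_le_left |p| 1) hy
        linarith
      refine this.trans ?_
      rw [Real.exp_neg]
      have h2 : 1 + m * y ≤ Real.exp (m * y) := by linarith [Real.add_one_le_exp (m * y)]
      have hmy : 0 ≤ m * y := by positivity
      have h3 : (Real.exp (m*y))⁻¹ ≤ (1 + m * y)⁻¹ := inv_anti₀ (by positivity) h2
      refine h3.trans ?_
      have h4 : m * (y / (1+y)) ≤ m * y / (1 + m * y) := by
        rw [← mul_div_assoc]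
        apply div_le_div_of_nonneg_left hmy (by positivity)
        have := mul_le_mul_of_nonneg_right (min_le_right |p| 1) hy
        linarith
      have h5 : (1 + m * y)⁻¹ = 1 - m * y / (1 + m * y) := by field_simp; ring
      linarith
    have := gs_pos x
    calc gs x * (Real.exp (-u) * Real.exp (-(|p| * y)))
        ≤ gs x * (Real.exp (-u) * (1 - m * (y / (1 + y)))) := by gcongr
      _ = _ := by ring
  set G := ∫ x in A, gs x
  set Q := ∫ x in A, gs x * (|x - a| / (1 + |x - a|))
  have hQ : 0 ≤ m * Q := mul_nonneg hm0 (by linarith)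
  have hE := Real.exp_pos (-u)
  have h6 := hF.trans hJ
  have hu0 : 1 ≤ Real.exp (-u) := by
    by_contra h
    push Not at h
    nlinarith
  have hmK : m * K ≤ ε := by
    have : m * K ≤ m * Q := by gcongr
    nlinarith
  refine ⟨by simpa using hu0, ?_⟩
  rcases le_total |p| 1 with h | h
  · rwa [hm, min_eq_left h] at hmK
  · rw [hm, min_eq_right h] at hmK; linarith

noncomputable def bd (a x : ℝ) : ℝ :=
  gs x * Real.exp (-(-2) - (-2) * (x - a)) + gs x * Real.exp (-(-2) - 2 * (x - a))

lemma bd_int (a : ℝ) : Integrable (bd a) := (gs_tilt (-2) (-2) a).add (gs_tilt (-2) 2 a)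

lemma tilt_close (a u p s x : ℝ) (hs1 : s ≤ 1) (hu : |u| ≤ s) (hp : |p| ≤ s) :
    |gs x * Real.exp (-u - p * (x - a)) - gs x| ≤ s * bd a x := by
  have hg := gs_pos x
  have hs0 : 0 ≤ s := (abs_nonneg _).trans hu
  set v := -u - p * (x - a) with hv
  have hy : 0 ≤ |x - a| := abs_nonneg _
  have hvb : |v| ≤ s * (1 + |x - a|) := by
    have : |v| ≤ |u| + |p| * |x - a| := by
      rw [hv, ← abs_mul, ← abs_neg u]; exact abs_sub _ _
    have := mul_le_mul_of_nonneg_right hp hy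
    linarith
  have h1 : |Real.exp v - 1| ≤ |v| * Real.exp |v| := by
    have e1 := Real.add_one_le_exp v
    have e2 := Real.add_one_le_exp (-v)
    have e3 : Real.exp v * Real.exp (-v) = 1 := by rw [← Real.exp_add]; simp
    have e4 := Real.exp_pos v
    rcases le_total 0 v with h | h
    · rw [abs_of_nonneg (by linarith : 0 ≤ Real.exp v - 1), abs_of_nonneg h]
      nlinarith
    · rw [abs_of_nonpos (by simpa using h), abs_of_nonpos h]
      have : 1 ≤ Real.exp (-v) := by simpa using h
      nlinarith
  have h2 : |v| * Real.exp |v| ≤ s * Real.exp (2 * (1 + |x - a|)) := by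
    have a1 : Real.exp |v| ≤ Real.exp (1 + |x-a|) := by
      apply Real.exp_le_exp.2; nlinarith
    have a2 : 1 + |x - a| ≤ Real.exp (1 + |x-a|) := by linarith [Real.add_one_le_exp (1+|x-a|)]
    calc |v| * Real.exp |v| ≤ (s * (1 + |x-a|)) * Real.exp (1 + |x-a|) := by gcongr
      _ ≤ (s * Real.exp (1 + |x-a|)) * Real.exp (1 + |x-a|) := by gcongr
      _ = _ := by rw [mul_assoc, ← Real.exp_add]; congr 2; ring
  have h3 : Real.exp (2 * (1 + |x - a|)) ≤
      Real.exp (-(-2) - (-2) * (x - a)) + Real.exp (-(-2) - 2 * (x - a)) := by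
    rcases abs_cases (x - a) with ⟨h, _⟩ | ⟨h, _⟩ <;> rw [h]
    · have : Real.exp (2 * (1 + (x - a))) = Real.exp (-(-2) - (-2) * (x - a)) := by
        congr 1; ring
      rw [this]; linarith [Real.exp_pos (-(-2) - 2 * (x - a))]
    · have : Real.exp (2 * (1 + -(x - a))) = Real.exp (-(-2) - 2 * (x - a)) := by
        congr 1; ring
      rw [this]; linarith [Real.exp_pos (-(-2) - (-2) * (x - a))]
  have : gs x * Real.exp v - gs x = gs x * (Real.exp v - 1) := by ring
  rw [this, abs_mul, abs_of_pos hg]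
  calc gs x * |Real.exp v - 1| ≤ gs x * (s * (Real.exp (-(-2) - (-2) * (x - a)) + Real.exp (-(-2) - 2 * (x - a)))) := by
        gcongr; exact (h1.trans h2).trans (by gcongr)
    _ = _ := by unfold bd; ring

/-- tail estimate -/
lemma tail_s7 (a u p s r : ℝ) (hs1 : s ≤ 1) (hu : |u| ≤ s) (hp : |p| ≤ s)
    (A B : Set ℝ) (hA : MeasurableSet A) (hB : MeasurableSet B) (hBA : B ⊆ A)
    (F : ℝ → ℝ) (hF : Integrable F) (hFA : ∫ x in A, F x = ∫ x in A, gs x)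
    (hFE : ∀ x, F x ≤ gs x * Real.exp (-u - p * (x - a)))
    (hFB : ∀ x ∈ B, F x ≤ Real.exp (-r) * (gs x * Real.exp (-u - p * (x - a))))
    (hr0 : 0 < r) (hr1 : r ≤ 1) :
    r / 2 * ((∫ x in B, gs x) - s * ∫ x, bd a x) ≤ s * ∫ x, bd a x := by
  set E := fun x => gs x * Real.exp (-u - p * (x - a)) with hE
  have hEi : Integrable E := gs_tilt u p a
  have hE0 : ∀ x, 0 ≤ E x := fun x => by have := gs_pos x; positivity
  have hbd0 : ∀ x, 0 ≤ s * bd a x := fun x =>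
    (abs_nonneg _).trans (tilt_close a u p s x hs1 hu hp)
  have hbi : Integrable (fun x => s * bd a x) := (bd_int a).const_mul s
  have hle : ∀ D : Set ℝ, ∫ x in D, s * bd a x ≤ s * ∫ x, bd a x := fun D => by
    rw [← integral_const_mul]
    exact setIntegral_le_integral hbi (Filter.Eventually.of_forall hbd0)
  have c1 : ∫ x in A, E x ≤ (∫ x in A, gs x) + s * ∫ x, bd a x := by
    refine le_trans ?_ (add_le_add_right (hle A) _)
    rw [← integral_add gs_int.integrableOn hbi.integrableOn]
    refine setIntegral_mono hEi.integrableOn (gs_int.add hbi).integrableOn fun x => ?_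
    have := (abs_le.1 (tilt_close a u p s x hs1 hu hp)).2
    simp only [hE]; linarith
  have c2 : ∫ x in B, gs x ≤ (∫ x in B, E x) + s * ∫ x, bd a x := by
    refine le_trans ?_ (add_le_add_right (hle B) _)
    rw [← integral_add hEi.integrableOn hbi.integrableOn]
    refine setIntegral_mono gs_int.integrableOn (hEi.add hbi).integrableOn fun x => ?_
    have := (abs_le.1 (tilt_close a u p s x hs1 hu hp)).1
    simp only [hE]; linarith
  have hr : r / 2 ≤ 1 - Real.exp (-r) := by
    have e1 := Real.add_one_le_exp r
    have e3 : Real.exp r * Real.exp (-r) = 1 := by rw [← Real.exp_add]; simp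
    have e4 := Real.exp_pos (-r)
    nlinarith
  have c3 : (∫ x in A, F x) ≤ (∫ x in A, E x) - r / 2 * ∫ x in B, E x := by
    have : ∫ x in B, E x = ∫ x in A, B.indicator E x := by
      rw [setIntegral_indicator hB, inter_eq_right.2 hBA]
    rw [this, ← integral_const_mul, ← integral_sub hEi.integrableOn
      ((hEi.indicator hB).const_mul _).integrableOn]
    refine setIntegral_mono hF.integrableOn
      (hEi.sub ((hEi.indicator hB).const_mul _)).integrableOn fun x => ?_
    by_cases hx : x ∈ B
    · have h1 := hFB x hx
      have h2 := hE0 x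
      simp only [indicator_of_mem hx]
      change F x ≤ Real.exp (-r) * E x at h1
      nlinarith
    · simp only [indicator_of_notMem hx]
      have := hFE x
      simpa using this
  have : r / 2 * ((∫ x in B, gs x) - s * ∫ x, bd a x) ≤ r / 2 * ∫ x in B, E x := by
    gcongr; linarith
  linarith

lemma K_pos (a : ℝ) (A : Set ℝ) (hA : MeasurableSet A) (hAv : 0 < volume (A \ {a})) :
    0 < ∫ x in A, gs x * (|x - a| / (1 + |x - a|)) := by
  have hq : Integrable (fun x => gs x * (|x - a| / (1 + |x - a|))) := by
    refine gs_int.mono' ?_ (Filter.Eventually.of_forall fun x => ?_)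
    · refine Continuous.aestronglyMeasurable ?_
      refine gs_cont.mul (Continuous.div (by fun_prop) (by fun_prop) fun x => ?_)
      positivity
    · have := gs_pos x
      rw [Real.norm_eq_abs, abs_of_nonneg (by positivity)]
      apply mul_le_of_le_one_right this.le
      rw [div_le_one (by positivity)]; linarith
  rw [setIntegral_pos_iff_support_of_nonneg_ae]
  · refine lt_of_lt_of_le hAv (measure_mono ?_)
    rintro x ⟨hx, hxa⟩
    refine ⟨?_, hx⟩
    have := gs_pos x
    have : 0 < |x - a| := abs_pos.2 (sub_ne_zero.2 hxa)
    exact (by positivity : 0 < gs x * (|x - a| / (1 + |x - a|))).ne'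
  · refine Filter.Eventually.of_forall fun x => ?_
    have := gs_pos x
    change 0 ≤ gs x * (|x - a| / (1 + |x - a|)); positivity
  · exact hq.integrableOn

lemma gs_Iic_ivt (b : ℝ) (hb0 : 0 < b) (hb1 : b < 1) : ∃ t, ∫ x in Iic t, gs x = b := by
  have hc : Continuous (fun t => ∫ x in Iic t, gs x) := by
    have : (fun t => ∫ x in Iic t, gs x) =
        fun t => (∫ x in Iic (0:ℝ), gs x) + ∫ x in (0:ℝ)..t, gs x := by
      ext t
      rw [← intervalIntegral.integral_Iic_sub_Iic gs_int.integrableOn gs_int.integrableOn]; ring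
    rw [this]
    exact continuous_const.add (gs_int.continuous_primitive 0)
  have h0 : Filter.Tendsto (fun t => ∫ x in Iic t, gs x) Filter.atBot (nhds 0) :=
    tendsto_integral_Iic_zero (f := gs) (μ := volume) Filter.tendsto_id
  have h1 : Filter.Tendsto (fun t => ∫ x in Iic t, gs x) Filter.atTop (nhds 1) := by
    rw [← gs_total]
    exact (aecover_Iic Filter.tendsto_id).integral_tendsto_of_countably_generated gs_int
  obtain ⟨t0, ht0⟩ := (h0.eventually (gt_mem_nhds hb0)).exists
  obtain ⟨t1, ht1⟩ := (h1.eventually (lt_mem_nhds hb1)).exists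
  exact mem_range_of_exists_le_of_exists_ge hc ⟨t0, ht0.le⟩ ⟨t1, ht1.le⟩

lemma supp_line (I : Set ℝ) (h : ℝ → ℝ) (a p : ℝ) (hc : ConvexOn ℝ I h) (ha : a ∈ interior I)
    (hd : HasDerivWithinAt h p (Ici a) a) : ∀ x ∈ I, h a + p * (x - a) ≤ h x := by
  intro x hx
  have haI := interior_subset ha
  have hd' : HasDerivWithinAt h p (Ioi a) a := hd.mono Ioi_subset_Ici_self
  rcases lt_trichotomy x a with hxa | rfl | hxa
  · rw [hasDerivWithinAt_iff_tendsto_slope' (by simp)] at hd'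
    have : (h a - h x) / (a - x) ≤ p := by
      refine ge_of_tendsto hd' ?_
      have hI : I ∈ nhdsWithin a (Ioi a) := mem_nhdsWithin_of_mem_nhds (mem_interior_iff_mem_nhds.1 ha)
      filter_upwards [hI, self_mem_nhdsWithin] with y hy hya
      rw [slope_def_field]
      exact hc.slope_mono_adjacent hx hy hxa hya
    rw [div_le_iff₀ (by linarith)] at this
    linarith
  · simp
  · have := hc.le_slope_of_hasDerivWithinAt_Ioi haI hx hxa hd'
    rw [slope_def_field, le_div_iff₀ (by linarith)] at this
    linarith

set_option maxHeartbeats 1000000 in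
theorem stmt7 :
    ∀ θ ∈ Ioo (0:ℝ) 1, ∀ aθ : ℝ,
      (1 / Real.sqrt (2 * π)) * (∫ t in Iic aθ, Real.exp (-t ^ 2 / 2)) = θ →
      ∃ ω > (0:ℝ), ∃ δ₀ > (0:ℝ),
        ∀ (I : Set ℝ), IsClosed I → Convex ℝ I → (interior I).Nonempty →
        ∀ ψ : ℝ → ℝ, ConvexOn ℝ I (fun x => ψ x - x ^ 2 / 2) →
        (∫ x in I, Real.exp (-ψ x)) = 1 →
        ∀ δ : ℝ, 0 < δ → δ ≤ δ₀ →
        aθ ∈ interior I →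
        (∫ x in I ∩ Iic aθ, Real.exp (-ψ x)) = θ →
        Real.exp (-ψ aθ) ≤ Real.exp (-(Real.log (Real.sqrt (2 * π)) + aθ ^ 2 / 2)) + δ →
        ∀ ψp : ℝ, HasDerivWithinAt ψ ψp (Ici aθ) aθ →
          ∃ S ∈ I, ∃ T ∈ I, S < aθ ∧ aθ < T ∧
            (1 / Real.sqrt (2 * π)) * (∫ t in Ici T, Real.exp (-t ^ 2 / 2))
              ≤ Real.sqrt δ + ω * δ ∧
            (1 / Real.sqrt (2 * π)) * (∫ t in Iic S, Real.exp (-t ^ 2 / 2))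
              ≤ Real.sqrt δ + ω * δ ∧
            ∀ x ∈ Icc S T, ψ x - (Real.log (Real.sqrt (2 * π)) + x ^ 2 / 2) ≤
              (ψp - aθ) * (x - aθ) + ω * Real.sqrt δ := by
  rintro θ ⟨hθ0, hθ1⟩ a hθ
  have hgsI : ∀ A : Set ℝ, (1 / Real.sqrt (2 * π)) * (∫ t in A, Real.exp (-t ^ 2 / 2)) =
      ∫ x in A, gs x := fun A => by unfold gs; rw [integral_const_mul]
  simp only [hgsI] at hθ ⊢
  have hcompl : ∀ t, ∫ x in Ioi t, gs x = 1 - ∫ x in Iic t, gs x := fun t => by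
    have := integral_add_compl (measurableSet_Iic (a := t)) gs_int
    rw [gs_total, compl_Iic] at this
    linarith
  have hθ' : ∫ x in Ioi a, gs x = 1 - θ := by rw [hcompl, hθ]
  have hK1 := K_pos a (Iic a) measurableSet_Iic (by simp)
  have hK2 := K_pos a (Ioi a) measurableSet_Ioi (by simp)
  obtain ⟨K, hK0, hKa, hKb, hKc⟩ : ∃ K > (0:ℝ),
      K ≤ (∫ x in Iic a, gs x * (|x - a| / (1 + |x - a|))) ∧
      K ≤ (∫ x in Ioi a, gs x * (|x - a| / (1 + |x - a|))) ∧ K ≤ 1 :=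
    ⟨min (min _ _) 1, lt_min (lt_min hK1 hK2) one_pos,
      (min_le_left _ _).trans (min_le_left _ _), (min_le_left _ _).trans (min_le_right _ _),
      min_le_right _ _⟩
  have hga := gs_pos a
  obtain ⟨c, hc⟩ : ∃ c, c = 1 / gs a := ⟨_, rfl⟩
  have hc0 : 0 < c := by rw [hc]; positivity
  obtain ⟨M, hM⟩ : ∃ M, M = ∫ x, bd a x := ⟨_, rfl⟩
  have hM0 : 0 ≤ M := by
    rw [hM]; refine integral_nonneg fun x => ?_
    have := gs_pos x
    simp only [bd, Pi.zero_apply]; positivity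
  obtain ⟨C, hC⟩ : ∃ C, C = c * M / K := ⟨_, rfl⟩
  have hC0 : 0 ≤ C := by rw [hC]; positivity
  obtain ⟨ω, hω⟩ : ∃ ω, ω = 2 * C + 1 := ⟨_, rfl⟩
  have hω0 : 0 < ω := by linarith
  obtain ⟨t₀, ht0, ht1, ht2, ht3, ht4, ht5⟩ : ∃ t₀ > (0:ℝ), t₀ ≤ 1 ∧ t₀ ≤ K / (2 * c) ∧
      t₀ ≤ 1 / ω ∧ t₀ ≤ θ / 4 ∧ t₀ ≤ (1 - θ) / 4 := by
    have : 0 < 1 - θ := by linarith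
    refine ⟨min 1 (min (K / (2 * c)) (min (1 / ω) (min (θ/4) ((1-θ)/4)))), by positivity, ?_⟩
    simp
  refine ⟨ω, hω0, t₀ ^ 2, by positivity, ?_⟩
  intro I hIcl hIcv _ ψ hψ hmass δ hδ0 hδ ha hmassL hdens ψp hder
  have haI := interior_subset ha
  obtain ⟨d, hd⟩ : ∃ d, d = √δ := ⟨_, rfl⟩
  have hd0 : 0 < d := by rw [hd]; positivity
  have hdd : δ = d ^ 2 := by rw [hd, Real.sq_sqrt hδ0.le]
  have hdt : d ≤ t₀ := by rw [hd]; exact Real.sqrt_le_iff.2 ⟨ht0.le, hδ⟩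
  rw [← hd]
  have hωd : ω * d ≤ 1 := by
    have := hdt.trans ht3
    rw [le_div_iff₀ hω0] at this; linarith
  have hcδ : c * δ ≤ K / 2 := by
    have h1 := hdt.trans ht2
    rw [le_div_iff₀ (by positivity)] at h1
    have : d ≤ 1 := hdt.trans ht1
    have : c * d * d ≤ c * d * 1 := by gcongr
    rw [hdd]; nlinarith
  -- the difference h
  obtain ⟨h, hh⟩ : ∃ h : ℝ → ℝ, h = fun x => ψ x - (Real.log (√(2*π)) + x ^ 2 / 2) := ⟨_, rfl⟩
  have hψh : ∀ x, Real.exp (-ψ x) = gs x * Real.exp (-h x) := fun x => by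
    have hZ : 0 < √(2*π) := by positivity
    have : gs x = Real.exp (-Real.log (√(2*π)) + -x^2/2) := by
      rw [Real.exp_add, Real.exp_neg, Real.exp_log hZ]; simp [gs]
    rw [this, ← Real.exp_add, hh]; congr 1; ring
  have hgsexp : Real.exp (-(Real.log (√(2*π)) + a ^ 2 / 2)) = gs a := by
    have hZ : 0 < √(2*π) := by positivity
    rw [neg_add, Real.exp_add, Real.exp_neg, Real.exp_log hZ]; simp [gs]; left; ring
  have hhc : ConvexOn ℝ I h := by
    have := hψ.add_const (-Real.log (√(2*π)))
    refine this.congr fun x _ => ?_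
    simp [hh]; ring
  obtain ⟨p, hp⟩ : ∃ p, p = ψp - a := ⟨_, rfl⟩
  have hhd : HasDerivWithinAt h p (Ici a) a := by
    have h1 : HasDerivAt (fun x : ℝ => Real.log (√(2*π)) + x ^ 2 / 2) a a := by
      have := ((hasDerivAt_pow 2 a).div_const 2).const_add (Real.log (√(2*π)))
      exact this.congr_deriv (by simp)
    rw [hh, hp]
    exact hder.sub h1.hasDerivWithinAt
  have hsupp := supp_line I h a p hhc ha hhd
  obtain ⟨u, hu⟩ : ∃ u, u = h a := ⟨_, rfl⟩
  rw [← hu] at hsupp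
  have hexpu : Real.exp (-u) ≤ 1 + c * δ := by
    rw [hψh a, hgsexp, ← hu] at hdens
    have : gs a * c = 1 := by rw [hc]; field_simp
    have h2 : gs a * Real.exp (-u) ≤ gs a * (1 + c * δ) := by
      rw [mul_add, ← mul_assoc, this]; linarith
    exact le_of_mul_le_mul_left h2 hga
  -- F
  obtain ⟨F, hF⟩ : ∃ F : ℝ → ℝ, F = I.indicator (fun x => Real.exp (-ψ x)) := ⟨_, rfl⟩
  have hFi : Integrable F := by
    rw [hF, integrable_indicator_iff hIcl.measurableSet]
    by_contra hn
    rw [integral_undef hn] at hmass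
    exact zero_ne_one hmass
  have hF1 : ∫ x, F x = 1 := by rw [hF, integral_indicator hIcl.measurableSet, hmass]
  have hFL : ∫ x in Iic a, F x = ∫ x in Iic a, gs x := by
    rw [hF, setIntegral_indicator hIcl.measurableSet, inter_comm, hmassL, hθ]
  have hFR : ∫ x in Ioi a, F x = ∫ x in Ioi a, gs x := by
    have := integral_add_compl (measurableSet_Iic (a := a)) hFi
    rw [compl_Iic, hFL, hF1] at this
    rw [hθ']; linarith
  have hFE : ∀ x, F x ≤ gs x * Real.exp (-u - p * (x - a)) := fun x => by
    have := gs_pos x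
    by_cases hx : x ∈ I
    · rw [hF, indicator_of_mem hx, hψh]
      have := hsupp x hx
      gcongr; linarith
    · rw [hF, indicator_of_notMem hx]; positivity
  have hup : u ≤ 0 ∧ |p| * K ≤ c * δ := by
    rcases le_total 0 p with hp0 | hp0
    · refine p_bound a u p (c*δ) K (Ioi a) measurableSet_Ioi ?_ (by linarith) (by linarith) ?_
        hexpu (by positivity) hKb hK0 (by linarith)
      · rw [← hFR]
        exact setIntegral_mono hFi.integrableOn (gs_tilt u p a).integrableOn hFE
      · intro x hx
        have : a < x := hx
        rw [abs_of_nonneg hp0, abs_of_pos (by linarith)]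
    · refine p_bound a u p (c*δ) K (Iic a) measurableSet_Iic ?_ (by linarith) (by linarith) ?_
        hexpu (by positivity) hKa hK0 (by linarith)
      · rw [← hFL]
        exact setIntegral_mono hFi.integrableOn (gs_tilt u p a).integrableOn hFE
      · intro x hx
        have : x ≤ a := hx
        rw [abs_of_nonpos hp0, abs_of_nonpos (by linarith)]; ring
  obtain ⟨hu0, hpK⟩ := hup
  obtain ⟨s, hs⟩ : ∃ s, s = c * δ / K := ⟨_, rfl⟩
  have hps : |p| ≤ s := by rw [hs, le_div_iff₀ hK0]; exact hpK
  have hs1 : s ≤ 1 := by rw [hs, div_le_one hK0]; linarith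
  have hus : |u| ≤ s := by
    rw [abs_of_nonpos hu0]
    have h1 : -u ≤ c * δ := by linarith [Real.add_one_le_exp (-u)]
    have h2 : c * δ ≤ s := by
      rw [hs, le_div_iff₀ hK0]
      exact mul_le_of_le_one_right (by positivity) hKc
    linarith
  have hsM : s * M = C * d ^ 2 := by rw [hs, hC, hdd]; ring
  have hcontra : ∀ A B : Set ℝ, MeasurableSet A → MeasurableSet B → B ⊆ A →
      ∫ x in A, F x = ∫ x in A, gs x → ∫ x in B, gs x = d + ω * δ →
      (∀ x ∈ B, x ∈ I → ω * d < h x - u - p * (x - a)) → False := by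
    intro A B hA hB hBA hFA hBβ hk
    have := tail_s7 a u p s (ω * d) hs1 hus hps A B hA hB hBA F hFi hFA hFE ?_ (by positivity) hωd
    · rw [← hM, hBβ, hsM, hdd] at this
      have h3 : 0 < ω * d * (ω * d ^ 2 - C * d ^ 2) := by
        have : 0 < (ω - C) * d ^ 2 := mul_pos (by linarith) (by positivity)
        have := mul_pos (mul_pos hω0 hd0) this
        linarith
      have h4 : 0 < d ^ 2 := by positivity
      have h5 : ω * d ^ 2 = 2 * (C * d^2) + d^2 := by rw [hω]; ring
      clear * - this h3 h4 h5
      linarith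
    · intro x hx
      have hgx := gs_pos x
      by_cases hxI : x ∈ I
      · have := hk x hx hxI
        rw [hF, indicator_of_mem hxI, hψh, mul_left_comm, ← Real.exp_add]
        gcongr; linarith
      · rw [hF, indicator_of_notMem hxI]; positivity
  have hkc : ConvexOn ℝ I (fun x => h x - u - p * (x - a)) := by
    refine ⟨hIcv, fun x hx y hy α β hα hβ hαβ => ?_⟩
    have := hhc.2 hx hy hα hβ hαβ
    simp only [smul_eq_mul] at this ⊢
    have e : β = 1 - α := by linarith
    subst e
    linarith
  have hka : h a - u - p * (a - a) = 0 := by rw [hu]; ring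
  have hωd0 : 0 < ω * d := by positivity
  have hβ0 : 0 < d + ω * δ := by positivity
  have hβ2 : d + ω * δ ≤ 2 * d := by rw [hdd]; have := mul_le_mul_of_nonneg_right hωd hd0.le; linarith
  have hmono : Monotone (fun t => ∫ x in Iic t, gs x) := fun s t hst =>
    setIntegral_mono_set gs_int.integrableOn (Filter.Eventually.of_forall fun x => (gs_pos x).le)
      (Iic_subset_Iic.2 hst).eventuallyLE
  obtain ⟨S, hS⟩ := gs_Iic_ivt (d + ω * δ) hβ0 (by linarith)
  obtain ⟨T, hT⟩ := gs_Iic_ivt (1 - (d + ω * δ)) (by linarith) (by linarith)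
  have hSa : S < a := by
    by_contra hn
    have := hmono (not_lt.1 hn)
    simp only at this; linarith
  have hTa : a < T := by
    by_contra hn
    have := hmono (not_lt.1 hn)
    simp only at this; linarith
  have hT' : ∫ x in Ici T, gs x = d + ω * δ := by
    rw [integral_Ici_eq_integral_Ioi, hcompl, hT]; ring
  have hSk : S ∈ I ∧ h S - u - p * (S - a) ≤ ω * d := by
    by_contra hn
    refine hcontra (Iic a) (Iic S) measurableSet_Iic measurableSet_Iic
      (Iic_subset_Iic.2 hSa.le) hFL hS fun x hx hxI => ?_
    have hSI : S ∈ I := hIcv.ordConnected.out hxI haI ⟨hx, hSa.le⟩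
    have h1 : ω * d < h S - u - p * (S - a) := by
      by_contra h'; exact hn ⟨hSI, not_lt.1 h'⟩
    have h2 := hkc.le_max_of_mem_Icc hxI haI (z := S) ⟨hx, hSa.le⟩
    simp only [hka] at h2
    rcases le_max_iff.1 h2 with h3 | h3 <;> linarith
  have hTk : T ∈ I ∧ h T - u - p * (T - a) ≤ ω * d := by
    by_contra hn
    refine hcontra (Ioi a) (Ici T) measurableSet_Ioi measurableSet_Ici
      (Ici_subset_Ioi.2 hTa) hFR hT' fun x hx hxI => ?_
    have hTI : T ∈ I := hIcv.ordConnected.out haI hxI ⟨hTa.le, hx⟩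
    have h1 : ω * d < h T - u - p * (T - a) := by
      by_contra h'; exact hn ⟨hTI, not_lt.1 h'⟩
    have h2 := hkc.le_max_of_mem_Icc haI hxI (z := T) ⟨hTa.le, hx⟩
    simp only [hka] at h2
    rcases le_max_iff.1 h2 with h3 | h3 <;> linarith
  refine ⟨S, hSk.1, T, hTk.1, hSa, hTa, hT'.le, hS.le, fun x hx => ?_⟩
  have h2 := (hkc.le_max_of_mem_Icc hSk.1 hTk.1 hx).trans (max_le hSk.2 hTk.2)
  have h3 : ψ x - (Real.log (√(2*π)) + x ^ 2 / 2) = h x := by rw [hh]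
  rw [h3, ← hp]
  linarith
end

section
/- For every α ≥ 0 and every a ∈ ℝ: ∫_a^∞ e^{−α(x−a)} γ(dx) ≤ (1 + α a + (α²/2)(a² + 1)) · γ([a, ∞)) − (α + α² a / 2) · (2π)^{−1/2} e^{−a²/2}. -/
open MeasureTheory Real Set

lemma aux_exp (t : ℝ) (ht : 0 ≤ t) : Real.exp (-t) ≤ 1 - t + t ^ 2 / 2 := by
  have h := Real.quadratic_le_exp_of_nonneg ht
  have h0 : 0 < 1 - t + t ^ 2 / 2 := by nlinarith [sq_nonneg (t - 1)]
  rw [Real.exp_neg, inv_le_iff_one_le_mul₀ (Real.exp_pos t)]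
  have := mul_le_mul_of_nonneg_left h h0.le
  nlinarith [sq_nonneg (t ^ 2)]

theorem stmt10 (α a : ℝ) (hα : 0 ≤ α) :
    (∫ x in Ici a, Real.exp (-α * (x - a)) * ((1 / Real.sqrt (2 * π)) * Real.exp (-x ^ 2 / 2)))
      ≤ (1 + α * a + α ^ 2 / 2 * (a ^ 2 + 1)) *
          ((1 / Real.sqrt (2 * π)) * ∫ x in Ici a, Real.exp (-x ^ 2 / 2))
        - (α + α ^ 2 * a / 2) * ((1 / Real.sqrt (2 * π)) * Real.exp (-a ^ 2 / 2)) := by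
  have e : ∀ x : ℝ, Real.exp (-x ^ 2 / 2) = Real.exp (-(1 / 2) * x ^ 2) := fun x => by
    congr 1; ring
  have i0 : Integrable (fun x : ℝ => Real.exp (-x ^ 2 / 2)) := by
    simp only [e]; exact integrable_exp_neg_mul_sq (by norm_num)
  have i1 : Integrable (fun x : ℝ => x * Real.exp (-x ^ 2 / 2)) := by
    simp only [e]; exact integrable_mul_exp_neg_mul_sq (by norm_num)
  have i2 : Integrable (fun x : ℝ => x ^ 2 * Real.exp (-x ^ 2 / 2)) := by
    simp only [e]
    have := integrable_rpow_mul_exp_neg_mul_sq (b := 1 / 2) (by norm_num) (s := 2) (by norm_num)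
    simpa only [Real.rpow_two] using this
  set F : ℝ → ℝ := fun x => (α + α ^ 2 * a) * Real.exp (-x ^ 2 / 2)
    - α ^ 2 / 2 * (x * Real.exp (-x ^ 2 / 2)) with hF
  set F' : ℝ → ℝ := fun x => -(α + α ^ 2 * a) * (x * Real.exp (-x ^ 2 / 2))
    + α ^ 2 / 2 * (x ^ 2 * Real.exp (-x ^ 2 / 2)) - α ^ 2 / 2 * Real.exp (-x ^ 2 / 2) with hF'
  have iF : Integrable F := (i0.const_mul _).sub (i1.const_mul _)
  have iF' : Integrable F' := ((i1.const_mul _).add (i2.const_mul _)).sub (i0.const_mul _)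
  have hE : ∀ x : ℝ, HasDerivAt (fun x : ℝ => Real.exp (-x ^ 2 / 2))
      (Real.exp (-x ^ 2 / 2) * (-x)) x := fun x => by
    have h : HasDerivAt (fun x : ℝ => -x ^ 2 / 2) (-x) x := by
      have := ((hasDerivAt_pow 2 x).neg).div_const 2
      refine HasDerivAt.congr_deriv this ?_
      simp; ring
    exact h.exp
  have hd : ∀ x : ℝ, HasDerivAt F (F' x) x := fun x => by
    have := ((hE x).const_mul (α + α ^ 2 * a)).sub
      ((((hasDerivAt_id x).mul (hE x))).const_mul (α ^ 2 / 2))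
    refine HasDerivAt.congr_deriv this ?_
    simp only [hF', id]
    ring
  have ht := tendsto_zero_of_hasDerivAt_of_integrableOn_Ioi (a := a) (fun x _ => hd x)
    iF'.integrableOn iF.integrableOn
  have hI := integral_Ioi_of_hasDerivAt_of_tendsto' (a := a) (fun x _ => hd x)
    iF'.integrableOn ht
  set c := 1 / Real.sqrt (2 * π) with hc
  have hc0 : 0 ≤ c := by positivity
  set K := 1 + α * a + α ^ 2 / 2 * (a ^ 2 + 1) with hK
  have iR : Integrable (fun x : ℝ => c * (K * Real.exp (-x ^ 2 / 2) + F' x)) :=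
    ((i0.const_mul _).add iF').const_mul _
  have hle : ∀ x ∈ Ici a, Real.exp (-α * (x - a)) * (c * Real.exp (-x ^ 2 / 2))
      ≤ c * (K * Real.exp (-x ^ 2 / 2) + F' x) := fun x hx => by
    have h := aux_exp (α * (x - a)) (mul_nonneg hα (sub_nonneg.2 hx))
    have h2 := mul_le_mul_of_nonneg_right h
      (mul_nonneg hc0 (Real.exp_pos (-x ^ 2 / 2)).le)
    rw [neg_mul]
    refine h2.trans (le_of_eq ?_)
    simp only [hF', hK]
    ring
  have hm := integral_mono_of_nonneg (μ := volume.restrict (Ici a))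
    (Filter.Eventually.of_forall fun x => by positivity) iR.integrableOn
    ((ae_restrict_iff' measurableSet_Ici).2 (Filter.Eventually.of_forall hle))
  refine hm.trans (le_of_eq ?_)
  rw [integral_const_mul, integral_add (i0.const_mul _).integrableOn iF'.integrableOn,
    integral_const_mul, integral_Ici_eq_integral_Ioi (f := F'), hI]
  simp only [hF]
  ring
end

section
/- With the notation below, for every θ ∈ (0,1) and ε ∈ (0,1) there exist constants C(θ, ε) > 0 and δ₀(θ, ε) > 0 with the following property: if I ⊂ ℝ is a closed interval with nonempty interior, ψ: I → ℝ is 1-convex, m := e^{−ψ} dx is a probability measure on I, δ ∈ (0, δ₀(θ, ε)], a_θ lies in the interior of I, m(I ∩ (−∞, a_θ]) = θ, and e^{−ψ(a_θ)} ≤ e^{−ψ_g(a_θ)} + δ, then |∫_I x m(dx)| ≤ C(θ, ε) · δ^{(1−ε)/4}. -/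
open MeasureTheory Real Set

lemma aux_slope (γ : Measure ℝ) [IsProbabilityMeasure γ] (S T : Set ℝ) (hS : MeasurableSet S)
    (hT : MeasurableSet T) (hTS : T ⊆ S) (hp : 0 < γ.real T) (f t : ℝ → ℝ) (K s η : ℝ)
    (hK : 0 < K) (hs : 0 ≤ s) (hKη : K ≤ 1 + η)
    (ht0 : ∀ x ∈ S, 0 ≤ t x) (ht1 : ∀ x ∈ T, 1 ≤ t x)
    (hf : ∀ x, f x ≤ K * exp (-(s * t x))) (hfi : Integrable f γ)
    (hfS : ∫ x in S, f x ∂γ = γ.real S) :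
    (1 - exp (-s)) * γ.real T ≤ η := by
  have hr : 0 ≤ 1 - exp (-s) := by
    have : exp (-s) ≤ 1 := exp_le_one_iff.2 (by linarith)
    linarith
  have hTi : Integrable (T.indicator (fun _ => (1:ℝ))) (γ.restrict S) :=
    (integrable_const _).indicator hT
  have h1 : ∫ x in S, f x ∂γ ≤
      ∫ x in S, K * (1 - (1 - exp (-s)) * T.indicator (fun _ => (1:ℝ)) x) ∂γ := by
    apply setIntegral_mono_on hfi.integrableOn _ hS
    · intro x hx
      refine (hf x).trans ?_
      apply mul_le_mul_of_nonneg_left _ hK.le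
      by_cases hxT : x ∈ T
      · simp only [hxT, indicator_of_mem, mul_one, sub_sub_cancel]
        apply exp_le_exp.2
        have := ht1 x hxT
        nlinarith
      · simp only [hxT, not_false_eq_true, indicator_of_notMem, mul_zero, sub_zero]
        apply exp_le_one_iff.2
        have := mul_nonneg hs (ht0 x hx)
        linarith
    · exact ((integrable_const _).sub (hTi.const_mul _)).const_mul _
  have h2 : ∫ x in S, K * (1 - (1 - exp (-s)) * T.indicator (fun _ => (1:ℝ)) x) ∂γ
      = K * (γ.real S - (1 - exp (-s)) * γ.real T) := by
    rw [integral_const_mul, integral_sub (integrable_const _) (hTi.const_mul _),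
      integral_const_mul, integral_indicator hT, Measure.restrict_restrict hT,
      inter_eq_left.2 hTS]
    simp
  rw [hfS, h2] at h1
  have hm1 : γ.real S ≤ 1 := measureReal_le_one
  have hpm : γ.real T ≤ γ.real S := measureReal_mono hTS
  have hrp := mul_nonneg hr hp.le
  have hK1 : 1 ≤ K := by
    by_contra h
    push Not at h
    nlinarith [mul_nonneg hK.le hrp]
  nlinarith [mul_nonneg (sub_nonneg.2 hK1) hrp, mul_nonneg (sub_nonneg.2 hK1) (sub_nonneg.2 hm1)]

lemma aux_log (s u : ℝ) (h : 1 - exp (-s) ≤ u) (hu : u ≤ 1/2) (hu0 : 0 ≤ u) : s ≤ 2 * u := by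
  have h1 : exp s * exp (-s) = 1 := by rw [← exp_add]; simp
  have h2 := add_one_le_exp s
  have h3 := exp_pos s
  have h4 : exp s * (1 - u) ≤ 1 := by nlinarith
  nlinarith

lemma aux_exp_s13 (s t : ℝ) (hs : |s| ≤ 1) : |exp (-(s * t)) - 1| ≤ |s| * exp (2 * |t|) := by
  have h : |exp (-(s * t)) - 1| ≤ |s * t| * exp |s * t| := by
    have h1 := add_one_le_exp (-(s * t))
    have h2 := add_one_le_exp (s * t)
    have h3 : exp (s * t) * exp (-(s * t)) = 1 := by rw [← exp_add]; simp
    have h4 := exp_pos (-(s*t))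
    have h5 : 1 ≤ exp |s * t| := one_le_exp (abs_nonneg _)
    have h6 : exp (-(s * t)) ≤ exp |s * t| := exp_le_exp.2 (neg_le_abs _)
    rw [abs_le]
    have h7 := le_abs_self (s * t)
    have h8 := neg_le_abs (s * t)
    have h9 := abs_nonneg (s * t)
    constructor
    · nlinarith
    · have : exp (-(s*t)) - 1 ≤ -(s*t) * exp (-(s*t)) := by nlinarith
      have : -(s*t) * exp (-(s*t)) ≤ |s*t| * exp (-(s*t)) := mul_le_mul_of_nonneg_right h8 h4.le
      have : |s*t| * exp (-(s*t)) ≤ |s*t| * exp (|s*t|) := mul_le_mul_of_nonneg_left h6 h9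
      linarith
  refine h.trans ?_
  have h1 : |s * t| ≤ |t| := by
    rw [abs_mul]; exact mul_le_of_le_one_left (abs_nonneg _) hs
  have h2 : exp |s * t| ≤ exp |t| := exp_le_exp.2 h1
  have h3 : |t| ≤ exp |t| := by linarith [add_one_le_exp |t|]
  have h4 : exp (2 * |t|) = exp |t| * exp |t| := by rw [← exp_add]; ring_nf
  rw [h4, abs_mul, mul_assoc]
  apply mul_le_mul_of_nonneg_left _ (abs_nonneg _)
  rw [← abs_mul]
  exact mul_le_mul h3 h2 (exp_pos _).le (exp_pos _).le

lemma aux_G (a : ℝ) : Integrable (fun x : ℝ => (1 + x ^ 2) * exp (2 * |x - a|))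
    (ProbabilityTheory.gaussianReal 0 1) := by
  have h1 := ProbabilityTheory.integrable_exp_mul_gaussianReal (μ := 0) (v := 1) 4
  have h2 := ProbabilityTheory.integrable_exp_mul_gaussianReal (μ := 0) (v := 1) (-4)
  apply ((h1.add h2).const_mul (2 * exp (2 * |a|))).mono' (by fun_prop)
  refine ae_of_all _ fun x => ?_
  rw [Real.norm_of_nonneg (by positivity)]
  have e1 : exp (2 * |x - a|) ≤ exp (2 * |a|) * exp (2 * |x|) := by
    rw [← exp_add]; apply exp_le_exp.2
    linarith [abs_sub x a]
  have e2 : 1 + x ^ 2 ≤ 2 * exp (2 * |x|) := by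
    have := quadratic_le_exp_of_nonneg (x := 2 * |x|) (by positivity)
    have h := sq_abs x
    nlinarith [abs_nonneg x]
  have e3 : exp (2 * |x|) * exp (2 * |x|) ≤ exp (4 * x) + exp (-4 * x) := by
    rw [← exp_add]
    rcases abs_cases x with ⟨h, _⟩ | ⟨h, _⟩ <;> rw [h]
    · have := exp_pos (-4 * x)
      ring_nf at this ⊢; linarith
    · have := exp_pos (4 * x)
      ring_nf at this ⊢; linarith
  calc (1 + x ^ 2) * exp (2 * |x - a|) ≤ (2 * exp (2 * |x|)) * (exp (2 * |a|) * exp (2 * |x|)) :=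
        mul_le_mul e2 e1 (by positivity) (by positivity)
    _ = 2 * exp (2 * |a|) * (exp (2 * |x|) * exp (2 * |x|)) := by ring
    _ ≤ 2 * exp (2 * |a|) * (exp (4 * x) + exp (-4 * x)) := by gcongr

set_option maxHeartbeats 1000000 in
lemma aux_main (a c : ℝ) (hc : 0 < c) : ∃ C > (0:ℝ), ∃ δ₀ > (0:ℝ), δ₀ ≤ 1 ∧
    ∀ (f : ℝ → ℝ) (K s δ : ℝ), 0 < δ → δ ≤ δ₀ → 0 < K → K ≤ 1 + c * δ →
    (∀ x, 0 ≤ f x) → (∀ x, f x ≤ K * exp (-(s * (x - a)))) →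
    Integrable f (ProbabilityTheory.gaussianReal 0 1) →
    ∫ x, f x ∂(ProbabilityTheory.gaussianReal 0 1) = 1 →
    ∫ x in Iic a, f x ∂(ProbabilityTheory.gaussianReal 0 1)
      = (ProbabilityTheory.gaussianReal 0 1).real (Iic a) →
    |∫ x, x * f x ∂(ProbabilityTheory.gaussianReal 0 1)| ≤ C * √δ := by
  have hid : ∫ x, x ∂(ProbabilityTheory.gaussianReal 0 1) = 0 := by
    exact ProbabilityTheory.integral_id_gaussianReal (μ := 0) (v := 1)
  have hidi : Integrable (fun x : ℝ => x) (ProbabilityTheory.gaussianReal 0 1) :=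
    (ProbabilityTheory.memLp_id_gaussianReal (μ := 0) (v := 1) 1).integrable (by simp)
  have hac := ProbabilityTheory.gaussianReal_absolutelyContinuous' 0 (v := 1) one_ne_zero
  have hG := aux_G a
  set γ := ProbabilityTheory.gaussianReal 0 1 with hγ
  have hpos : ∀ T : Set ℝ, volume T ≠ 0 → 0 < γ.real T := by
    intro T hT
    refine ENNReal.toReal_pos (fun h => hT (hac h)) (measure_ne_top _ _)
  have hp1 : 0 < γ.real (Ici (a + 1)) := hpos _ (by simp)
  have hp2 : 0 < γ.real (Iic (a - 1)) := hpos _ (by simp)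
  obtain ⟨p, hp, hpp1, hpp2⟩ : ∃ p > 0, p ≤ γ.real (Ici (a + 1)) ∧ p ≤ γ.real (Iic (a - 1)) :=
    ⟨_, lt_min hp1 hp2, min_le_left _ _, min_le_right _ _⟩
  set G : ℝ → ℝ := fun x => (1 + x ^ 2) * exp (2 * |x - a|) with hGdef
  set M := ∫ x, G x ∂γ with hM
  have hM0 : 0 ≤ M := integral_nonneg fun x => by simp only [hGdef]; positivity
  set c1 := 2 * (c / p) with hc1
  have hc1p : 0 < c1 := by positivity
  refine ⟨M + c / 2 + 3 * c1 * M + 1, by positivity, min 1 (min (1 / c1) (1 / c)), by positivity,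
    min_le_left _ _, ?_⟩
  intro f K s δ hδ hδ0 hK hKc hf0 hfU hfi hf1 hfa
  have hδ1 : δ ≤ 1 := hδ0.trans (min_le_left _ _)
  have hδc1 : c1 * δ ≤ 1 := by
    have : δ ≤ 1 / c1 := hδ0.trans ((min_le_right _ _).trans (min_le_left _ _))
    rw [le_div_iff₀ hc1p] at this; linarith
  have hδc : c * δ ≤ 1 := by
    have : δ ≤ 1 / c := hδ0.trans ((min_le_right _ _).trans (min_le_right _ _))
    rw [le_div_iff₀ hc] at this; linarith
  have hfin : ∀ r q : ℝ, 0 ≤ r → p ≤ q → (1 - exp (-r)) * q ≤ c * δ → r ≤ c1 * δ := by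
    intro r q hr hq h
    have h0 : 0 ≤ 1 - exp (-r) := by
      have : exp (-r) ≤ 1 := exp_le_one_iff.2 (by linarith)
      linarith
    have h1 : 1 - exp (-r) ≤ c / p * δ := by
      rw [div_mul_eq_mul_div, le_div_iff₀ hp]
      nlinarith
    have := aux_log r (c / p * δ) h1 (by rw [hc1] at hδc1; linarith) (by positivity)
    rw [hc1]; linarith
  have hs : |s| ≤ c1 * δ := by
    rcases le_total 0 s with h | h
    · rw [abs_of_nonneg h]
      apply hfin s _ h hpp1
      have hco : ∫ x in Ioi a, f x ∂γ = γ.real (Ioi a) := by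
        have e1 := integral_add_compl (μ := γ) (measurableSet_Iic (a := a)) hfi
        have e2 := measureReal_add_measureReal_compl (μ := γ) (measurableSet_Iic (a := a))
        rw [compl_Iic] at e1 e2
        simp only [probReal_univ] at e2
        linarith
      exact aux_slope γ (Ioi a) (Ici (a+1)) measurableSet_Ioi measurableSet_Ici
        (fun x hx => by simp only [mem_Ici, mem_Ioi] at *; linarith) hp1 f (fun x => x - a) K s _
        hK h hKc (fun x hx => by simp only [mem_Ioi] at *; linarith)
        (fun x hx => by simp only [mem_Ici] at *; linarith) hfU hfi hco
    · rw [abs_of_nonpos h]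
      apply hfin (-s) _ (by linarith) hpp2
      exact aux_slope γ (Iic a) (Iic (a-1)) measurableSet_Iic measurableSet_Iic
        (fun x hx => by simp only [mem_Iic] at *; linarith) hp2 f (fun x => a - x) K (-s) _
        hK (by linarith) hKc (fun x hx => by simp only [mem_Iic] at *; linarith)
        (fun x hx => by simp only [mem_Iic] at *; linarith)
        (fun x => (hfU x).trans_eq (by ring_nf)) hfi hfa
  have hs1 : |s| ≤ 1 := hs.trans hδc1
  have hK2 : K ≤ 2 := by linarith
  set E : ℝ → ℝ := fun x => exp (-(s * (x - a))) with hE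
  have hE1 : ∀ x, |E x - 1| ≤ |s| * exp (2 * |x - a|) := fun x => aux_exp_s13 s (x - a) hs1
  have hEe : ∀ x, E x ≤ exp (2 * |x - a|) := by
    intro x
    apply exp_le_exp.2
    have h1 : |s * (x - a)| ≤ |x - a| := by
      rw [abs_mul]; exact mul_le_of_le_one_left (abs_nonneg _) hs1
    linarith [neg_le_abs (s * (x - a)), abs_nonneg (x - a)]
  have hE0 : ∀ x, 0 ≤ E x := fun x => (exp_pos _).le
  have hEm : Continuous E := by fun_prop
  have hGe : ∀ x, exp (2 * |x - a|) ≤ G x := fun x => by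
    simp only [hGdef]; nlinarith [exp_pos (2 * |x - a|), sq_nonneg x]
  have hGx : ∀ x, |x| * exp (2 * |x - a|) ≤ G x := fun x => by
    simp only [hGdef]
    apply mul_le_mul_of_nonneg_right _ (exp_pos _).le
    nlinarith [sq_abs x, sq_nonneg (|x| - 1)]
  have hGx2 : ∀ x, x ^ 2 * exp (2 * |x - a|) ≤ G x := fun x => by
    simp only [hGdef]; nlinarith [exp_pos (2 * |x - a|), sq_nonneg x]
  have hfm := hfi.aestronglyMeasurable
  -- integrability
  have iE : Integrable E γ := hG.mono' hEm.aestronglyMeasurable (ae_of_all _ fun x => by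
    rw [Real.norm_of_nonneg (hE0 x)]; exact (hEe x).trans (hGe x))
  have ixE : Integrable (fun x => x * E x) γ := hG.mono' (by fun_prop) (ae_of_all _ fun x => by
    rw [norm_mul, Real.norm_of_nonneg (hE0 x), Real.norm_eq_abs]
    exact (mul_le_mul_of_nonneg_left (hEe x) (abs_nonneg _)).trans (hGx x))
  have ix2E : Integrable (fun x => x ^ 2 * E x) γ := hG.mono' (by fun_prop) (ae_of_all _ fun x => by
    rw [norm_mul, Real.norm_of_nonneg (hE0 x), Real.norm_of_nonneg (sq_nonneg x)]
    exact (mul_le_mul_of_nonneg_left (hEe x) (sq_nonneg _)).trans (hGx2 x))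
  have hnf : ∀ x, ‖f x‖ ≤ K * E x := fun x => by
    rw [Real.norm_of_nonneg (hf0 x)]; exact hfU x
  have ixf : Integrable (fun x => x * f x) γ := by
    apply (ixE.norm.const_mul K).mono' (continuous_id.aestronglyMeasurable.mul hfm)
    refine ae_of_all _ fun x => ?_
    change ‖x * f x‖ ≤ K * ‖x * E x‖
    rw [norm_mul, norm_mul, Real.norm_of_nonneg (hE0 x)]
    nlinarith [hnf x, norm_nonneg x]
  have ix2f : Integrable (fun x => x ^ 2 * f x) γ := by
    apply (ix2E.const_mul K).mono' ((continuous_pow 2).aestronglyMeasurable.mul hfm)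
    refine ae_of_all _ fun x => ?_
    change ‖x ^ 2 * f x‖ ≤ K * (x ^ 2 * E x)
    rw [norm_mul, Real.norm_of_nonneg (sq_nonneg x)]
    nlinarith [hnf x, sq_nonneg x]
  -- estimates
  have b1 : ∫ x, E x ∂γ ≤ 1 + |s| * M := by
    have : ∫ x, E x ∂γ ≤ ∫ x, (1 + |s| * G x) ∂γ := by
      apply integral_mono iE ((integrable_const _).add (hG.const_mul _))
      intro x
      have h1 := (abs_le.1 (hE1 x)).2
      have h2 := mul_le_mul_of_nonneg_left (hGe x) (abs_nonneg s)
      change E x ≤ 1 + |s| * G x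
      linarith
    rw [integral_add (integrable_const _) (hG.const_mul _), integral_const_mul] at this
    simpa using this
  have b2 : ∫ x, x ^ 2 * E x ∂γ ≤ M :=
    integral_mono ix2E hG fun x =>
      (mul_le_mul_of_nonneg_left (hEe x) (sq_nonneg _)).trans (hGx2 x)
  have b3 : |∫ x, x * E x ∂γ| ≤ |s| * M := by
    have h1 : ∫ x, x * E x ∂γ = ∫ x, x * (E x - 1) ∂γ := by
      have : ∫ x, x * (E x - 1) ∂γ = ∫ x, (x * E x - x) ∂γ := by
        congr 1; ext x; ring
      rw [this, integral_sub ixE hidi, hid, sub_zero]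
    rw [h1, hM, ← integral_const_mul, ← Real.norm_eq_abs (∫ x, _ ∂γ)]
    apply norm_integral_le_of_norm_le (hG.const_mul _)
    refine ae_of_all _ fun x => ?_
    rw [norm_mul, Real.norm_eq_abs, Real.norm_eq_abs]
    calc |x| * |E x - 1| ≤ |x| * (|s| * exp (2 * |x - a|)) :=
          mul_le_mul_of_nonneg_left (hE1 x) (abs_nonneg _)
      _ = |s| * (|x| * exp (2 * |x - a|)) := by ring
      _ ≤ |s| * G x := mul_le_mul_of_nonneg_left (hGx x) (abs_nonneg _)
  have b4 : 0 ≤ ∫ x, x ^ 2 * f x ∂γ := integral_nonneg fun x => mul_nonneg (sq_nonneg _) (hf0 x)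
  have hsq : 0 < √δ := sqrt_pos.2 hδ
  have hsq2 : √δ * √δ = δ := mul_self_sqrt hδ.le
  have j1 : Integrable (fun x => √δ / 2 * (K * (x ^ 2 * E x) - x ^ 2 * f x)) γ :=
    ((ix2E.const_mul K).sub ix2f).const_mul _
  have j2 : Integrable (fun x => 1 / (2 * √δ) * (K * E x - f x)) γ :=
    ((iE.const_mul K).sub hfi).const_mul _
  -- difference
  have b5 : |∫ x, (x * f x - K * (x * E x)) ∂γ| ≤
      ∫ x, (√δ / 2 * (K * (x ^ 2 * E x) - x ^ 2 * f x) + 1 / (2 * √δ) * (K * E x - f x)) ∂γ := by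
    rw [← Real.norm_eq_abs]
    apply norm_integral_le_of_norm_le
    · exact j1.add j2
    refine ae_of_all _ fun x => ?_
    have hD : 0 ≤ K * E x - f x := sub_nonneg.2 (hfU x)
    have : x * f x - K * (x * E x) = -(x * (K * E x - f x)) := by ring
    rw [this, norm_neg, norm_mul, Real.norm_of_nonneg hD, Real.norm_eq_abs]
    have h2 : |x| ≤ √δ / 2 * x ^ 2 + 1 / (2 * √δ) := by
      have : √δ / 2 * x ^ 2 + 1 / (2 * √δ) - |x| = (√δ * |x| - 1) ^ 2 / (2 * √δ) := by
        rw [← sq_abs x]; field_simp; ring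
      have : 0 ≤ (√δ * |x| - 1) ^ 2 / (2 * √δ) := by positivity
      linarith
    calc _ ≤ _ := mul_le_mul_of_nonneg_right h2 hD
      _ = _ := by ring
  rw [integral_add j1 j2, integral_const_mul, integral_const_mul,
      integral_sub (ix2E.const_mul K) ix2f, integral_sub (iE.const_mul K) hfi,
      integral_const_mul, integral_const_mul, integral_sub ixf (ixE.const_mul K),
      integral_const_mul, hf1] at b5
  set A := ∫ x, x * f x ∂γ
  set B := ∫ x, x * E x ∂γ
  have hsM : |s| * M ≤ c1 * δ * M := mul_le_mul_of_nonneg_right hs hM0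
  have d1 : K * ∫ x, E x ∂γ ≤ 1 + (c + 2 * c1 * M) * δ := by
    have : K * ∫ x, E x ∂γ ≤ K * (1 + |s| * M) := mul_le_mul_of_nonneg_left b1 hK.le
    have : K * (|s| * M) ≤ 2 * (c1 * δ * M) :=
      mul_le_mul hK2 hsM (mul_nonneg (abs_nonneg _) hM0) (by norm_num)
    nlinarith
  have d2 : K * ∫ x, x ^ 2 * E x ∂γ ≤ 2 * M := by
    have : K * ∫ x, x ^ 2 * E x ∂γ ≤ K * M := mul_le_mul_of_nonneg_left b2 hK.le
    nlinarith
  have d3 : |K * B| ≤ 2 * (c1 * δ * M) := by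
    rw [abs_mul, abs_of_pos hK]
    exact mul_le_mul hK2 (b3.trans hsM) (abs_nonneg _) (by norm_num)
  have d4 : √δ / 2 * (K * ∫ x, x ^ 2 * E x ∂γ - ∫ x, x ^ 2 * f x ∂γ) ≤ √δ / 2 * (2 * M) := by
    apply mul_le_mul_of_nonneg_left _ (by positivity); linarith
  have d5 : 1 / (2 * √δ) * (K * ∫ x, E x ∂γ - 1) ≤ (c + 2 * c1 * M) / 2 * √δ := by
    have : 1 / (2 * √δ) * (K * ∫ x, E x ∂γ - 1) ≤ 1 / (2 * √δ) * ((c + 2 * c1 * M) * δ) := by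
      apply mul_le_mul_of_nonneg_left _ (by positivity); linarith
    refine this.trans_eq ?_
    rw [← hsq2]
    field_simp
    simp
  have d6 : |A| ≤ |A - K * B| + |K * B| := by
    have := abs_add_le (A - K * B) (K * B)
    simpa using this
  have d7 : δ ≤ √δ := by
    have h1 : √δ ≤ 1 := sqrt_le_one.2 hδ1
    have h2 := mul_le_mul_of_nonneg_left h1 hsq.le
    rw [hsq2, mul_one] at h2
    exact h2
  have d8 : 2 * (c1 * δ * M) ≤ 2 * (c1 * √δ * M) := by gcongr
  have d9 : (M + c / 2 + 3 * c1 * M + 1) * √δ = √δ / 2 * (2 * M) + (c + 2 * c1 * M) / 2 * √δ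
      + 2 * (c1 * √δ * M) + √δ := by ring
  linarith

lemma aux_subgrad (I : Set ℝ) (φ : ℝ → ℝ) (h : ConvexOn ℝ I φ) (a : ℝ) (ha : a ∈ interior I) :
    ∃ s : ℝ, ∀ x ∈ I, φ a + s * (x - a) ≤ φ x := by
  refine ⟨derivWithin φ (Ioi a) a, fun x hx => ?_⟩
  rcases lt_trichotomy x a with hxa | rfl | hxa
  · have h1 := h.slope_le_leftDeriv_of_mem_interior hx ha hxa
    have h2 := h1.trans (h.leftDeriv_le_rightDeriv_of_mem_interior ha)
    rw [slope_def_field, div_le_iff₀ (by linarith)] at h2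
    linarith
  · simp
  · have h1 := h.rightDeriv_le_slope_of_mem_interior ha hx hxa
    rw [slope_def_field, le_div_iff₀ (by linarith)] at h1
    linarith

lemma aux_conv (I : Set ℝ) (ψ k : ℝ → ℝ) (hI : MeasurableSet I) :
    ∫ x, k x * I.indicator (fun x => √(2 * π) * exp (x ^ 2 / 2 - ψ x)) x
      ∂(ProbabilityTheory.gaussianReal 0 1) = ∫ x in I, k x * exp (-ψ x) := by
  rw [ProbabilityTheory.integral_gaussianReal_eq_integral_smul one_ne_zero, ← integral_indicator hI]
  congr 1
  ext x
  by_cases hx : x ∈ I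
  · simp only [hx, indicator_of_mem, ProbabilityTheory.gaussianPDFReal, smul_eq_mul]
    have h1 : exp (-ψ x) = exp (-(x - 0) ^ 2 / (2 * ((1 : NNReal) : ℝ))) * exp (x ^ 2 / 2 - ψ x) := by
      rw [← exp_add]; congr 1; simp; ring
    have h2 : √(2 * π) ≠ 0 := by positivity
    rw [h1]
    simp only [NNReal.coe_one, mul_one]
    field_simp
  · simp [hx]

theorem stmt13 :
    ∀ θ ∈ Ioo (0:ℝ) 1, ∀ ε ∈ Ioo (0:ℝ) 1, ∀ aθ : ℝ,
      (1 / Real.sqrt (2 * π)) * (∫ t in Iic aθ, Real.exp (-t ^ 2 / 2)) = θ →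
      ∃ C > (0:ℝ), ∃ δ₀ > (0:ℝ),
        ∀ (I : Set ℝ), IsClosed I → Convex ℝ I → (interior I).Nonempty →
        ∀ ψ : ℝ → ℝ, ConvexOn ℝ I (fun x => ψ x - x ^ 2 / 2) →
        (∫ x in I, Real.exp (-ψ x)) = 1 →
        ∀ δ : ℝ, 0 < δ → δ ≤ δ₀ →
        aθ ∈ interior I →
        (∫ x in I ∩ Iic aθ, Real.exp (-ψ x)) = θ →
        Real.exp (-ψ aθ) ≤ Real.exp (-(Real.log (Real.sqrt (2 * π)) + aθ ^ 2 / 2)) + δ →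
        |∫ x in I, x * Real.exp (-ψ x)| ≤ C * δ ^ ((1 - ε) / 4) := by
  intro θ hθ ε hε a ha
  have hsp : 0 < √(2 * π) := by positivity
  obtain ⟨C, hC, δ₀, hδ₀, hδ₀1, H⟩ := aux_main a (√(2 * π) * exp (a ^ 2 / 2)) (by positivity)
  refine ⟨C, hC, δ₀, hδ₀, ?_⟩
  intro I hI _ _ ψ hψ h1 δ hδ hδδ haI hθI hle
  have hIm := hI.measurableSet
  obtain ⟨s, hs⟩ := aux_subgrad I _ hψ a haI
  set f : ℝ → ℝ := I.indicator (fun x => √(2 * π) * exp (x ^ 2 / 2 - ψ x)) with hf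
  set K := √(2 * π) * exp (a ^ 2 / 2) * exp (-ψ a) with hK
  have hγ : (ProbabilityTheory.gaussianReal 0 1).real (Iic a) = θ := by
    rw [← ha, measureReal_def, ProbabilityTheory.gaussianReal_apply_eq_integral 0 one_ne_zero,
      ENNReal.toReal_ofReal
        (integral_nonneg fun x => ProbabilityTheory.gaussianPDFReal_nonneg _ _ _),
      ← integral_const_mul]
    congr 1
    ext x
    simp [ProbabilityTheory.gaussianPDFReal]
  have hf1 : ∫ x, f x ∂(ProbabilityTheory.gaussianReal 0 1) = 1 := by
    have := aux_conv I ψ (fun _ => 1) hIm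
    simp only [one_mul] at this
    rw [← h1]; exact this
  have hfi : Integrable f (ProbabilityTheory.gaussianReal 0 1) := by
    by_contra h
    rw [integral_undef h] at hf1
    norm_num at hf1
  have hfa : ∫ x in Iic a, f x ∂(ProbabilityTheory.gaussianReal 0 1) = θ := by
    rw [← integral_indicator measurableSet_Iic, ← hθI]
    have := aux_conv (I ∩ Iic a) ψ (fun _ => 1) (hIm.inter measurableSet_Iic)
    simp only [one_mul] at this
    rw [← this, hf, indicator_indicator, inter_comm]
  have hf0 : ∀ x, 0 ≤ f x := fun x => indicator_nonneg (fun x _ => by positivity) x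
  have hfU : ∀ x, f x ≤ K * exp (-(s * (x - a))) := by
    intro x
    by_cases hx : x ∈ I
    · simp only [hf, hx, indicator_of_mem, hK]
      rw [mul_assoc, mul_assoc, ← exp_add, ← exp_add]
      apply mul_le_mul_of_nonneg_left _ hsp.le
      apply exp_le_exp.2
      have := hs x hx
      linarith
    · simp only [hf, hx, not_false_eq_true, indicator_of_notMem]
      positivity
  have hKc : K ≤ 1 + √(2 * π) * exp (a ^ 2 / 2) * δ := by
    have e : √(2 * π) * exp (a ^ 2 / 2) * exp (-(log √(2 * π) + a ^ 2 / 2)) = 1 := by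
      rw [neg_add, exp_add, exp_neg, exp_neg, exp_log hsp]
      field_simp
    have := mul_le_mul_of_nonneg_left hle (a := √(2 * π) * exp (a ^ 2 / 2)) (by positivity)
    rw [mul_add, e] at this
    exact this
  have key := H f K s δ hδ hδδ (by positivity) hKc hf0 hfU hfi hf1 (by rw [hfa, hγ])
  rw [aux_conv I ψ (fun x => x) hIm] at key
  refine key.trans ?_
  apply mul_le_mul_of_nonneg_left _ hC.le
  rw [sqrt_eq_rpow]
  apply rpow_le_rpow_of_exponent_ge hδ (hδδ.trans hδ₀1)
  linarith [hε.1]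
end

section
/- With the notation below, for every θ ∈ (0,1) and ε ∈ (0,1) there exist constants C(θ, ε) > 0 and δ₀(θ, ε) > 0 with the following property: if I ⊂ ℝ is a closed interval with nonempty interior, ψ: I → ℝ is 1-convex, m := e^{−ψ} dx is a probability measure on I, δ ∈ (0, δ₀(θ, ε)], a_θ lies in the interior of I, m(I ∩ (−∞, a_θ]) = θ, and e^{−ψ(a_θ)} ≤ e^{−ψ_g(a_θ)} + δ, then ∫_I x² m(dx) ≥ 1 − C(θ, ε) · δ^{(1−ε)/2}. -/
open MeasureTheory Real Set

noncomputable def gd (x : ℝ) : ℝ := (1 / Real.sqrt (2 * π)) * Real.exp (-x ^ 2 / 2)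

lemma gd_pos (x : ℝ) : 0 < gd x := by unfold gd; positivity

lemma gd_cont : Continuous gd := by unfold gd; fun_prop

lemma gd_eq_pdf (x : ℝ) : gd x = ProbabilityTheory.gaussianPDFReal 0 1 x := by
  simp [gd, ProbabilityTheory.gaussianPDFReal]

lemma gd_int : ∫ x, gd x = 1 := by
  simp_rw [gd_eq_pdf]
  exact ProbabilityTheory.integral_gaussianPDFReal_eq_one 0 one_ne_zero

lemma gd_var : ∫ x, x ^ 2 * gd x = 1 := by
  have h := ProbabilityTheory.variance_fun_id_gaussianReal (μ := 0) (v := 1)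
  rw [ProbabilityTheory.variance_of_integral_eq_zero (by fun_prop)
    (ProbabilityTheory.integral_id_gaussianReal),
    ProbabilityTheory.integral_gaussianReal_eq_integral_smul one_ne_zero] at h
  simp_rw [gd_eq_pdf]
  simpa [mul_comm] using h

noncomputable def wt (a x : ℝ) : ℝ := (1 + x ^ 4) * (Real.exp |x - a| * gd x)

lemma wt_integrable (a : ℝ) : Integrable (wt a) := by
  have h0 := integrable_exp_neg_mul_sq (b := 1 / 4) (by norm_num)
  have h4 := integrable_rpow_mul_exp_neg_mul_sq (b := 1 / 4) (by norm_num) (s := 4) (by norm_num)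
  have h := ((h0.add h4).const_mul ((1 / Real.sqrt (2 * π)) * Real.exp (1 + |a|)))
  refine h.mono' ?_ (ae_of_all _ fun x => ?_)
  · have : Continuous (wt a) := by unfold wt; have := gd_cont; fun_prop
    exact this.aestronglyMeasurable
  · have hp : 0 ≤ wt a x := by unfold wt; have := (gd_pos x).le; positivity
    rw [Real.norm_of_nonneg hp]
    have e4 : x ^ (4 : ℝ) = x ^ 4 := by exact_mod_cast Real.rpow_natCast x 4
    have key : Real.exp |x - a| * Real.exp (-x ^ 2 / 2)
        ≤ Real.exp (1 + |a|) * Real.exp (-(1 / 4) * x ^ 2) := by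
      rw [← Real.exp_add, ← Real.exp_add]
      apply Real.exp_le_exp.mpr
      have := abs_sub x a
      nlinarith [sq_nonneg (|x| / 2 - 1), sq_abs x]
    simp only [Pi.add_apply, e4, wt, gd]
    calc _ = (1 / Real.sqrt (2 * π)) * (1 + x ^ 4) * (Real.exp |x - a| * Real.exp (-x ^ 2 / 2)) := by
          ring
      _ ≤ (1 / Real.sqrt (2 * π)) * (1 + x ^ 4) *
          (Real.exp (1 + |a|) * Real.exp (-(1 / 4) * x ^ 2)) := by gcongr
      _ = _ := by ring

lemma dom {a : ℝ} {f : ℝ → ℝ} (c : ℝ) (hf : AEStronglyMeasurable f)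
    (h : ∀ x, |f x| ≤ c * wt a x) : Integrable f :=
  ((wt_integrable a).const_mul c).mono' hf (ae_of_all _ h)

lemma gd_integrable : Integrable gd := by
  refine dom (a := 0) 1 gd_cont.aestronglyMeasurable fun x => ?_
  rw [abs_of_pos (gd_pos x), one_mul, wt]
  have h1 : 1 ≤ Real.exp |x - 0| := Real.one_le_exp (abs_nonneg _)
  have h2 : 1 ≤ 1 + x ^ 4 := by have : 0 ≤ x ^ 4 := by positivity
                                linarith
  have := gd_pos x
  nlinarith [mul_le_mul h2 h1 zero_le_one (by positivity)]

lemma exp_gd_integrable (a : ℝ) : Integrable (fun x => Real.exp |x - a| * gd x) := by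
  have hc := gd_cont
  refine dom (a := a) 1 (Continuous.aestronglyMeasurable (by fun_prop)) fun x => ?_
  have := gd_pos x
  rw [abs_of_pos (by positivity), one_mul, wt]
  have : 0 ≤ x ^ 4 * (Real.exp |x - a| * gd x) := by positivity
  nlinarith

lemma exp_conv {k t : ℝ} (h0 : 0 ≤ k) (h1 : k ≤ 1) : Real.exp (k * t) ≤ (1 - k) + k * Real.exp t := by
  have := convexOn_exp.2 (mem_univ 0) (mem_univ t) (sub_nonneg.2 h1) h0 (by ring)
  simpa using this

noncomputable def cS (a : ℝ) (S : Set ℝ) : ℝ := ∫ x in S, gd x * (1 - Real.exp (-|x - a|))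

lemma neg_integrable (a k : ℝ) (hk : 0 ≤ k) :
    Integrable (fun x => gd x * Real.exp (-(k * |x - a|))) := by
  have hc := gd_cont
  refine gd_integrable.mono' (Continuous.aestronglyMeasurable (by fun_prop))
    (ae_of_all _ fun x => ?_)
  have hg := gd_pos x
  rw [Real.norm_of_nonneg (by positivity)]
  have : Real.exp (-(k * |x - a|)) ≤ 1 := Real.exp_le_one_iff.2 (by
    have : 0 ≤ k * |x - a| := by positivity
    linarith)
  nlinarith

lemma cS_integrable (a : ℝ) : Integrable (fun x => gd x * (1 - Real.exp (-|x - a|))) := by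
  have := gd_integrable.sub (neg_integrable a 1 zero_le_one)
  refine this.congr (ae_of_all _ fun x => ?_)
  simp; ring

lemma cS_pos (a : ℝ) (S : Set ℝ) (hS : 0 < volume (S \ {a})) : 0 < cS a S := by
  unfold cS
  have hnn : ∀ x, 0 ≤ gd x * (1 - Real.exp (-|x - a|)) := fun x =>
    mul_nonneg (gd_pos x).le (sub_nonneg.2 (Real.exp_le_one_iff.2 (by simp)))
  rw [setIntegral_pos_iff_support_of_nonneg_ae (ae_of_all _ hnn) (cS_integrable a).integrableOn]
  refine hS.trans_le (measure_mono ?_)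
  rintro x ⟨hx, hxa⟩
  refine ⟨?_, hx⟩
  have : 0 < |x - a| := abs_pos.2 (sub_ne_zero.2 hxa)
  have : Real.exp (-|x - a|) < 1 := by
    rw [← Real.exp_zero]; exact Real.exp_lt_exp.2 (by linarith)
  exact (mul_pos (gd_pos x) (by linarith)).ne'

/-- one-sided slope bound -/
lemma slope_bd (a : ℝ) (S : Set ℝ) (κ d : ℝ) (hκ : 0 ≤ κ) (hd : 0 ≤ d)
    (h : ∫ x in S, gd x ≤ (1 + d) * ∫ x in S, gd x * Real.exp (-(κ * |x - a|))) :
    min κ 1 * cS a S ≤ d := by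
  set J := ∫ x in S, gd x * Real.exp (-(κ * |x - a|)) with hJ
  have hJ1 : J ≤ 1 := by
    calc J ≤ ∫ x in S, gd x := by
          refine integral_mono (neg_integrable a κ hκ).integrableOn gd_integrable.integrableOn ?_
          intro x
          have : Real.exp (-(κ * |x - a|)) ≤ 1 := Real.exp_le_one_iff.2 (by
            have : 0 ≤ κ * |x - a| := by positivity
            linarith)
          have := gd_pos x
          simp only; nlinarith
      _ ≤ ∫ x, gd x := setIntegral_le_integral gd_integrable (ae_of_all _ fun x => (gd_pos x).le)
      _ = 1 := gd_int
  have h2 : min κ 1 * cS a S ≤ (∫ x in S, gd x) - J := by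
    rw [cS, hJ, ← integral_const_mul,
      ← integral_sub gd_integrable.integrableOn (neg_integrable a κ hκ).integrableOn]
    refine integral_mono ((cS_integrable a).const_mul _).integrableOn
      (gd_integrable.sub (neg_integrable a κ hκ)).integrableOn ?_
    intro x
    have h1 := exp_conv (k := min κ 1) (t := -|x - a|) (le_min hκ zero_le_one) (min_le_right _ _)
    have h3 : Real.exp (-(κ * |x - a|)) ≤ Real.exp (min κ 1 * -|x - a|) :=
      Real.exp_le_exp.2 (by
        have := mul_le_mul_of_nonneg_right (min_le_left κ 1) (abs_nonneg (x - a))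
        linarith)
    have := gd_pos x
    simp only
    nlinarith
  nlinarith

set_option maxHeartbeats 2000000 in
lemma core (a θ : ℝ) (hθ : ∫ x in Iic a, gd x = θ) (D : ℝ) (hD : 0 < D) :
    ∃ C > (0:ℝ), ∃ δ₀ > (0:ℝ), δ₀ ≤ 1 ∧ ∀ (ρ : ℝ → ℝ), Integrable ρ → (∀ x, 0 ≤ ρ x) →
      ∫ x, ρ x = 1 → ∫ x in Iic a, ρ x = θ → ∀ δ : ℝ, 0 < δ → δ ≤ δ₀ →
      ∀ k : ℝ, (∀ x, ρ x ≤ (1 + D * δ) * (gd x * Real.exp (-(k * (x - a))))) →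
      1 - C * δ ^ ((1:ℝ) / 2) ≤ ∫ x, x ^ 2 * ρ x := by
  have hc1 : 0 < cS a (Iic a) := cS_pos _ _ (by simp)
  have hc2 : 0 < cS a (Ioi a) := cS_pos _ _ (by simp)
  set c := min (cS a (Iic a)) (cS a (Ioi a)) with hc
  have hc0 : 0 < c := lt_min hc1 hc2
  have hcl : c ≤ cS a (Iic a) := min_le_left _ _
  have hcr : c ≤ cS a (Ioi a) := min_le_right _ _
  set E := D / c with hE
  have hE0 : 0 < E := div_pos hD hc0
  set K := D + E + D * E with hK
  have hK0 : 0 < K := by positivity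
  set W := ∫ x, wt a x with hW
  have hWnn : 0 ≤ W := integral_nonneg fun x => by
    have := gd_pos x
    unfold wt; positivity
  refine ⟨K * W + (1 + K) * W + 1, by positivity, min 1 (c / (2 * D)), by positivity,
    min_le_left _ _, ?_⟩
  intro ρ hρ hρ0 hρ1 hρθ δ hδ hδ0 k hk
  have hδ1 : δ ≤ 1 := hδ0.trans (min_le_left _ _)
  have hδ2 : D * δ < c := by
    have := hδ0.trans (min_le_right _ _)
    rw [le_div_iff₀ (by positivity)] at this
    nlinarith
  -- slope bound
  have hmin : min |k| 1 * c ≤ D * δ := by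
    have hm0 : 0 ≤ min |k| 1 := le_min (abs_nonneg _) zero_le_one
    rcases le_total 0 k with h | h
    · refine (mul_le_mul_of_nonneg_left hcr hm0).trans (slope_bd a _ _ _ (abs_nonneg _) (by positivity) ?_)
      have e1 := integral_add_compl (measurableSet_Iic (a := a)) gd_integrable
      have e2 := integral_add_compl (measurableSet_Iic (a := a)) hρ
      rw [compl_Iic] at e1 e2
      have e3 : ∫ x in Ioi a, gd x = ∫ x in Ioi a, ρ x := by
        rw [gd_int] at e1; linarith
      rw [e3, ← integral_const_mul]
      refine setIntegral_mono_on hρ.integrableOn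
        ((neg_integrable a _ (abs_nonneg k)).const_mul _).integrableOn measurableSet_Ioi ?_
      intro x hx
      rw [abs_of_nonneg h, abs_of_pos (sub_pos.2 hx)]
      exact hk x
    · refine (mul_le_mul_of_nonneg_left hcl hm0).trans (slope_bd a _ _ _ (abs_nonneg _) (by positivity) ?_)
      rw [hθ, ← hρθ, ← integral_const_mul]
      refine setIntegral_mono_on hρ.integrableOn
        ((neg_integrable a _ (abs_nonneg k)).const_mul _).integrableOn measurableSet_Iic ?_
      intro x hx
      rw [abs_of_nonpos h, abs_of_nonpos (sub_nonpos.2 hx), neg_mul_neg]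
      exact hk x
  have hk1 : |k| ≤ 1 := by
    by_contra hh
    rw [min_eq_right (not_le.1 hh).le] at hmin
    linarith
  rw [min_eq_left hk1] at hmin
  have hkE : |k| ≤ E * δ := by
    rw [hE, div_mul_eq_mul_div, le_div_iff₀ hc0]; exact hmin
  -- pointwise bound
  have hG : ∀ x, ρ x ≤ gd x + K * δ * (Real.exp |x - a| * gd x) := by
    intro x
    have hg := gd_pos x
    have h1 : Real.exp (-(k * (x - a))) ≤ 1 + E * δ * Real.exp |x - a| := by
      calc Real.exp (-(k * (x - a))) ≤ Real.exp (|k| * |x - a|) := Real.exp_le_exp.2 (by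
            rw [← abs_mul]; exact neg_le_abs _)
        _ ≤ (1 - |k|) + |k| * Real.exp |x - a| := exp_conv (abs_nonneg _) hk1
        _ ≤ _ := by
          have := abs_nonneg k
          have := mul_le_mul_of_nonneg_right hkE (Real.exp_pos |x - a|).le
          linarith
    have h2 : 1 ≤ Real.exp |x - a| := Real.one_le_exp (abs_nonneg _)
    set X := Real.exp |x - a|
    have h3 : (1 + D * δ) * (1 + E * δ * X) ≤ 1 + K * δ * X := by
      have t1 : D * δ * 1 ≤ D * δ * X := mul_le_mul_of_nonneg_left h2 (by positivity)
      have t2 : D * E * δ * X * δ ≤ D * E * δ * X * 1 := mul_le_mul_of_nonneg_left hδ1 (by positivity)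
      rw [hK]; nlinarith
    calc ρ x ≤ (1 + D * δ) * (gd x * Real.exp (-(k * (x - a)))) := hk x
      _ ≤ (1 + D * δ) * (gd x * (1 + E * δ * X)) := by gcongr
      _ = gd x * ((1 + D * δ) * (1 + E * δ * X)) := by ring
      _ ≤ gd x * (1 + K * δ * X) := by gcongr
      _ = _ := by ring
  -- comparison
  set s := δ ^ ((1:ℝ) / 2) with hs
  have hs0 : 0 < s := Real.rpow_pos_of_pos hδ _
  have hss : s * s = δ := by rw [hs, ← Real.rpow_add hδ]; norm_num
  have hx2i : Integrable (fun x => x ^ 2 * gd x) := by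
    by_contra hh
    have := integral_undef hh
    rw [gd_var] at this
    norm_num at this
  have hpt : ∀ x, x ^ 2 * gd x - x ^ 2 * ρ x ≤
      s⁻¹ * (gd x - ρ x) + s⁻¹ * (K * δ) * wt a x + s * (1 + K) * wt a x := by
    intro x
    have hg := gd_pos x
    have h2 : 1 ≤ Real.exp |x - a| := Real.one_le_exp (abs_nonneg _)
    have hG' := hG x
    have hr := hρ0 x
    unfold wt
    set X := Real.exp |x - a|
    have hx : x ^ 2 ≤ s⁻¹ + s * x ^ 4 := by
      have h1 : 0 ≤ s⁻¹ * (1 - s * x ^ 2) ^ 2 := by positivity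
      have h3 : s⁻¹ * (1 - s * x ^ 2) ^ 2 = s⁻¹ - 2 * x ^ 2 + s * x ^ 4 := by
        field_simp; ring
      nlinarith [sq_nonneg x]
    have hT : 0 ≤ gd x + K * δ * (X * gd x) - ρ x := by linarith
    have hX0 : 0 < X := by linarith
    have b1 : x ^ 2 * (gd x - ρ x) ≤ x ^ 2 * (gd x + K * δ * (X * gd x) - ρ x) := by
      apply mul_le_mul_of_nonneg_left _ (sq_nonneg x)
      have : 0 ≤ K * δ * (X * gd x) := by positivity
      linarith
    have b2 := mul_le_mul_of_nonneg_right hx hT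
    have b3 : s * x ^ 4 * (gd x + K * δ * (X * gd x) - ρ x) ≤ s * x ^ 4 * ((1 + K) * (X * gd x)) := by
      apply mul_le_mul_of_nonneg_left _ (by positivity)
      have u1 : gd x ≤ X * gd x := le_mul_of_one_le_left hg.le h2
      have u2 : K * δ * (X * gd x) ≤ K * 1 * (X * gd x) := by gcongr
      linarith
    have b4 : 0 ≤ s * ((1 + K) * (X * gd x)) := by positivity
    have b5 : 0 ≤ s⁻¹ * (K * δ) * (x ^ 4 * (X * gd x)) := by positivity
    nlinarith
  have hx2ρ : Integrable (fun x => x ^ 2 * ρ x) := by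
    refine dom (a := a) (1 + K) (by
      have : AEStronglyMeasurable (fun x : ℝ => x ^ 2) := by fun_prop
      exact this.mul hρ.1) fun x => ?_
    have hg := gd_pos x
    rw [abs_of_nonneg (mul_nonneg (sq_nonneg x) (hρ0 x))]
    have h2 : 1 ≤ Real.exp |x - a| := Real.one_le_exp (abs_nonneg _)
    have hG' := hG x
    unfold wt
    set X := Real.exp |x - a|
    have hX0 : 0 < X := by linarith
    have u1 : gd x ≤ X * gd x := le_mul_of_one_le_left hg.le h2
    have u2 : K * δ * (X * gd x) ≤ K * 1 * (X * gd x) := by gcongr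
    calc x ^ 2 * ρ x ≤ (1 + x ^ 4) * ((1 + K) * (X * gd x)) := by
          apply mul_le_mul _ (by linarith) (hρ0 x) (by positivity)
          nlinarith [sq_nonneg (x ^ 2 - 1)]
      _ = _ := by ring
  have hwi := wt_integrable a
  have i1 : Integrable (fun x => s⁻¹ * (gd x - ρ x)) := (gd_integrable.sub hρ).const_mul _
  have i2 : Integrable (fun x => s⁻¹ * (K * δ) * wt a x) := hwi.const_mul _
  have i3 : Integrable (fun x => s * (1 + K) * wt a x) := hwi.const_mul _
  have fin := integral_mono (hx2i.sub hx2ρ) ((i1.add i2).add i3) hpt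
  rw [integral_add' (i1.add i2) i3, integral_add' i1 i2, integral_sub' hx2i hx2ρ,
    integral_const_mul, integral_const_mul, integral_const_mul,
    integral_sub gd_integrable hρ, gd_int, hρ1, gd_var, ← hW] at fin
  have e : s⁻¹ * (K * δ) = K * s := by rw [← hss]; field_simp
  rw [e] at fin
  nlinarith

lemma subgrad {I : Set ℝ} {u : ℝ → ℝ} (hu : ConvexOn ℝ I u) {a : ℝ} (ha : a ∈ interior I) :
    ∃ k : ℝ, ∀ x ∈ I, u a + k * (x - a) ≤ u x := by
  refine ⟨derivWithin u (Iio a) a, fun x hx => ?_⟩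
  rcases lt_trichotomy x a with h | h | h
  · have h1 := hu.slope_le_leftDeriv_of_mem_interior hx ha h
    rw [slope_def_field, div_le_iff₀ (by linarith)] at h1
    linarith
  · subst h; simp
  · have h1 := hu.rightDeriv_le_slope_of_mem_interior ha hx h
    have h2 := (hu.leftDeriv_le_rightDeriv_of_mem_interior ha).trans h1
    rw [slope_def_field, le_div_iff₀ (by linarith)] at h2
    linarith



theorem stmt14 :
    ∀ θ ∈ Ioo (0:ℝ) 1, ∀ ε ∈ Ioo (0:ℝ) 1, ∀ aθ : ℝ,
      (1 / Real.sqrt (2 * π)) * (∫ t in Iic aθ, Real.exp (-t ^ 2 / 2)) = θ →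
      ∃ C > (0:ℝ), ∃ δ₀ > (0:ℝ),
        ∀ (I : Set ℝ), IsClosed I → Convex ℝ I → (interior I).Nonempty →
        ∀ ψ : ℝ → ℝ, ConvexOn ℝ I (fun x => ψ x - x ^ 2 / 2) →
        (∫ x in I, Real.exp (-ψ x)) = 1 →
        ∀ δ : ℝ, 0 < δ → δ ≤ δ₀ →
        aθ ∈ interior I →
        (∫ x in I ∩ Iic aθ, Real.exp (-ψ x)) = θ →
        Real.exp (-ψ aθ) ≤ Real.exp (-(Real.log (Real.sqrt (2 * π)) + aθ ^ 2 / 2)) + δ →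
        (∫ x in I, x ^ 2 * Real.exp (-ψ x)) ≥ 1 - C * δ ^ ((1 - ε) / 2) := by
  intro θ hθ ε hε a ha
  have hg := gd_pos a
  have hθ' : ∫ x in Iic a, gd x = θ := by
    rw [← ha, ← integral_const_mul]; rfl
  obtain ⟨C, hC, δ₀, hδ₀, hδ₀1, H⟩ := core a θ hθ' (gd a)⁻¹ (by positivity)
  refine ⟨C, hC, δ₀, hδ₀, ?_⟩
  intro I hI _ _ ψ hψ hm δ hδ hδle haI hmθ hle
  have hIm : MeasurableSet I := hI.measurableSet
  obtain ⟨k, hk⟩ := subgrad hψ haI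
  have hint : IntegrableOn (fun x => Real.exp (-ψ x)) I := by
    by_contra hh
    rw [integral_undef hh] at hm
    norm_num at hm
  have hga : Real.exp (-(Real.log (Real.sqrt (2 * π)) + a ^ 2 / 2)) = gd a := by
    rw [neg_add, Real.exp_add, Real.exp_neg, Real.exp_log (by positivity), gd]
    simp [neg_div]
  rw [hga] at hle
  have key := H (I.indicator fun x => Real.exp (-ψ x)) (hint.integrable_indicator hIm)
    (fun x => indicator_nonneg (fun _ _ => (Real.exp_pos _).le) x)
    (by rw [integral_indicator hIm, hm])
    (by rw [setIntegral_indicator hIm, inter_comm, hmθ]) δ hδ hδle k (by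
      intro x
      have hgx := gd_pos x
      by_cases hx : x ∈ I
      · rw [indicator_of_mem hx]
        have h1 := hk x hx
        have h2 : gd x = gd a * Real.exp (a ^ 2 / 2 - x ^ 2 / 2) := by
          unfold gd
          rw [mul_assoc, ← Real.exp_add]
          ring_nf
        calc Real.exp (-ψ x) ≤ Real.exp (-ψ a + (a ^ 2 / 2 - x ^ 2 / 2) + -(k * (x - a))) :=
              Real.exp_le_exp.2 (by linarith)
          _ = Real.exp (-ψ a) * (Real.exp (a ^ 2 / 2 - x ^ 2 / 2) * Real.exp (-(k * (x - a)))) := by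
              rw [Real.exp_add, Real.exp_add, mul_assoc]
          _ ≤ (gd a + δ) * (Real.exp (a ^ 2 / 2 - x ^ 2 / 2) * Real.exp (-(k * (x - a)))) := by
              gcongr
          _ = _ := by rw [h2]; field_simp
      · rw [indicator_of_notMem hx]; positivity)
  have e : ∫ x, x ^ 2 * I.indicator (fun x => Real.exp (-ψ x)) x
      = ∫ x in I, x ^ 2 * Real.exp (-ψ x) := by
    rw [← integral_indicator hIm]
    congr 1; ext x
    by_cases hx : x ∈ I <;> simp [hx]
  rw [e] at key
  have hp : δ ^ ((1:ℝ) / 2) ≤ δ ^ ((1 - ε) / 2) :=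
    Real.rpow_le_rpow_of_exponent_ge hδ (hδle.trans hδ₀1) (by linarith [hε.1])
  have := mul_le_mul_of_nonneg_left hp hC.le
  linarith
end

section
/- For every a ∈ (0, 1/2) and every t ∈ ℝ with −1 < t ≤ 1/(2a) − 1: (1 + t) log(1 + t) ≥ t + a t². -/
open Real Set

theorem stmt16 (a t : ℝ) (ha : a ∈ Ioo (0:ℝ) (1/2))
    (ht1 : -1 < t) (ht2 : t ≤ 1 / (2 * a) - 1) :
    (1 + t) * Real.log (1 + t) ≥ t + a * t ^ 2 := by
  obtain ⟨ha0, ha1⟩ := ha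
  have hx : 0 < 1 + t := by linarith
  have hax : a * (1 + t) ≤ 1 / 2 := by
    have h : 1 + t ≤ 1 / (2 * a) := by linarith
    rw [le_div_iff₀ (by positivity)] at h
    linarith
  rcases le_total 0 t with h0 | h0
  · have hu0 : 0 ≤ t / (1 + t) := by positivity
    have hu1 : t / (1 + t) < 1 := by rw [div_lt_one hx]; linarith
    have hs := Real.hasSum_pow_div_log_of_abs_lt_one (x := t / (1 + t))
      (by rw [abs_of_nonneg hu0]; exact hu1)
    have h1 := sum_le_hasSum (Finset.range 2) (fun i _ => by positivity) hs
    have h2 : 1 - t / (1 + t) = (1 + t)⁻¹ := by field_simp; ring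
    rw [h2, Real.log_inv, neg_neg] at h1
    norm_num [Finset.sum_range_succ] at h1
    have h3 := mul_le_mul_of_nonneg_left h1 hx.le
    have h4 : (1 + t) * (t / (1 + t) + (t / (1 + t)) ^ 2 / 2) = t + t ^ 2 / (2 * (1 + t)) := by
      field_simp
    have h5 : a * t ^ 2 ≤ t ^ 2 / (2 * (1 + t)) := by
      rw [le_div_iff₀ (by positivity)]
      nlinarith [mul_le_mul_of_nonneg_right hax (sq_nonneg t)]
    linarith
  · have h1 : Real.sinh (Real.log (1 + t)) ≤ Real.log (1 + t) :=
      Real.sinh_le_self_iff.2 (Real.log_nonpos hx.le (by linarith))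
    rw [Real.sinh_log hx] at h1
    have h3 := mul_le_mul_of_nonneg_left h1 hx.le
    have h4 : (1 + t) * (((1 + t) - (1 + t)⁻¹) / 2) = t + t ^ 2 / 2 := by
      field_simp
      ring
    nlinarith [mul_le_mul_of_nonneg_right ha1.le (sq_nonneg t)]
end
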